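/- There exist constants C₁, C₂ > 0, depending only on a given constant c₀ > 0, such that for all integers S ≥ 2 and n ≥ 2 with n·ln S ≥ c₀·S, the minimax risk for estimating the Shannon entropy H(P) over P ∈ M_S under the Poissonized sampling model with parameter n satisfies C₁·( S²/(n·ln n)² + (ln S)²/n ) ≤ inf_{Ĥ} sup_{P ∈ M_S} E_P[(Ĥ(Z) − H(P))²] ≤ C₂·( S²/(n·ln n)² + (ln S)²/n ). -/

import Mathlib

open scoped BigOperators ENNReal

/-- The probability simplex on `S` outcomes. -/
def simplex (S : ℕ) : Set (Fin S → ℝ) :=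
  {P | (∀ i, 0 ≤ P i) ∧ ∑ i, P i = 1}

/-- Joint pmf of independent Poisson observations `Z i ~ Poisson (lam * P i)`. -/
noncomputable def poissonPMF (S : ℕ) (lam : ℝ) (P : Fin S → ℝ) (z : Fin S → ℕ) : ℝ :=
  ∏ i, Real.exp (-(lam * P i)) * (lam * P i) ^ (z i) / (Nat.factorial (z i) : ℝ)

/-- Expected squared error of an estimator under the Poissonized model. -/
noncomputable def poissonRisk (S : ℕ) (lam : ℝ) (P : Fin S → ℝ) (t : ℝ)
    (est : (Fin S → ℕ) → ℝ) : ℝ≥0∞ :=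
  ∑' z : Fin S → ℕ, ENNReal.ofReal (poissonPMF S lam P z * (est z - t) ^ 2)

/-- Minimax risk for estimating `F P` under the Poissonized model. -/
noncomputable def poissonMinimax (S : ℕ) (lam : ℝ) (F : (Fin S → ℝ) → ℝ) : ℝ≥0∞ :=
  ⨅ est : (Fin S → ℕ) → ℝ, ⨆ P ∈ simplex S, poissonRisk S lam P (F P) est

/-- Shannon entropy (with the convention `0 * log 0 = 0`, automatic since `Real.log 0 = 0`). -/
noncomputable def entropy (S : ℕ) (P : Fin S → ℝ) : ℝ :=
  ∑ i, -(P i * Real.log (P i))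

/-- The Poisson probability mass function with real parameter. -/
noncomputable def poi (r : ℝ) (k : ℕ) : ℝ := Real.exp (-r) * r ^ k / (Nat.factorial k : ℝ)

lemma poi_nonneg {r : ℝ} (hr : 0 ≤ r) (k : ℕ) : 0 ≤ poi r k := by
  unfold poi; positivity

lemma hasSum_pow_div_factorial (r : ℝ) :
    HasSum (fun k : ℕ => r ^ k / (Nat.factorial k : ℝ)) (Real.exp r) := by
  rw [Real.exp_eq_exp_ℝ]
  exact NormedSpace.expSeries_div_hasSum_exp r

lemma hasSum_poi (r : ℝ) : HasSum (poi r) 1 := by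
  have h := (hasSum_pow_div_factorial r).mul_left (Real.exp (-r))
  rw [← Real.exp_add, neg_add_cancel, Real.exp_zero] at h
  exact h.congr_fun fun k => mul_div_assoc _ _ _

lemma poi_succ_mul (r : ℝ) (k : ℕ) : poi r (k + 1) * ((k + 1 : ℕ) : ℝ) = r * poi r k := by
  unfold poi
  rw [Nat.factorial_succ]
  push_cast
  have : (Nat.factorial k : ℝ) ≠ 0 := by positivity
  have : (k : ℝ) + 1 ≠ 0 := by positivity
  field_simp
  ring

/-- `E[Z h(Z - 1)] = r E[h(Z)]` for `Z ~ Poisson r`. -/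
lemma hasSum_poi_shift {r a : ℝ} {h : ℕ → ℝ} (ha : HasSum (fun k => poi r k * h k) a) :
    HasSum (fun k : ℕ => poi r k * ((k : ℝ) * h (k - 1))) (r * a) := by
  rw [← hasSum_nat_add_iff' 1]
  simp only [Finset.range_one, Finset.sum_singleton, Nat.cast_zero, zero_mul, mul_zero, sub_zero,
    Nat.add_sub_cancel]
  refine (ha.mul_left r).congr_fun fun k => ?_
  rw [← mul_assoc, poi_succ_mul, mul_assoc]

lemma hasSum_poi_id (r : ℝ) : HasSum (fun k : ℕ => poi r k * (k : ℝ)) r := by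
  have h1 : HasSum (fun k : ℕ => poi r k * (fun _ => (1 : ℝ)) k) 1 := by simpa using hasSum_poi r
  simpa using hasSum_poi_shift h1

lemma hasSum_poi_falling_two (r : ℝ) :
    HasSum (fun k : ℕ => poi r k * ((k : ℝ) * ((k : ℝ) - 1))) (r ^ 2) := by
  have h := hasSum_poi_shift (hasSum_poi_id r)
  rw [← sq] at h
  convert h using 3 with k
  rcases k with _ | k <;> simp

lemma hasSum_poi_falling_three (r : ℝ) :
    HasSum (fun k : ℕ => poi r k * ((k : ℝ) * ((k : ℝ) - 1) * ((k : ℝ) - 2))) (r ^ 3) := by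
  have h := hasSum_poi_shift (hasSum_poi_falling_two r)
  rw [← pow_succ'] at h
  convert h using 3 with k
  rcases k with _ | k
  · simp
  · push_cast [Nat.add_sub_cancel]; ring

lemma hasSum_poi_falling_four (r : ℝ) :
    HasSum (fun k : ℕ => poi r k * ((k : ℝ) * ((k : ℝ) - 1) * ((k : ℝ) - 2) * ((k : ℝ) - 3)))
      (r ^ 4) := by
  have h := hasSum_poi_shift (hasSum_poi_falling_three r)
  rw [← pow_succ'] at h
  convert h using 3 with k
  rcases k with _ | k
  · simp
  · push_cast [Nat.add_sub_cancel]; ring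

lemma hasSum_poi_sq (r : ℝ) : HasSum (fun k : ℕ => poi r k * (k : ℝ) ^ 2) (r ^ 2 + r) := by
  convert (hasSum_poi_falling_two r).add (hasSum_poi_id r) using 2 with k
  ring

lemma hasSum_poi_pow_four (r : ℝ) :
    HasSum (fun k : ℕ => poi r k * (k : ℝ) ^ 4) (r ^ 4 + 6 * r ^ 3 + 7 * r ^ 2 + r) := by
  convert (((hasSum_poi_falling_four r).add ((hasSum_poi_falling_three r).mul_left 6)).add
    ((hasSum_poi_falling_two r).mul_left 7)).add (hasSum_poi_id r) using 2 with k
  ring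

lemma hasSum_poi_central_two (r : ℝ) :
    HasSum (fun k : ℕ => poi r k * ((k : ℝ) - r) ^ 2) r := by
  convert ((hasSum_poi_sq r).add ((hasSum_poi_id r).mul_left (-2 * r))).add
    ((hasSum_poi r).mul_left (r ^ 2)) using 2 with k <;> ring

lemma hasSum_poi_central_four (r : ℝ) :
    HasSum (fun k : ℕ => poi r k * ((k : ℝ) - r) ^ 4) (3 * r ^ 2 + r) := by
  convert (((((hasSum_poi_falling_four r).add
    ((hasSum_poi_falling_three r).mul_left (6 - 4 * r))).add
    ((hasSum_poi_falling_two r).mul_left (7 - 12 * r + 6 * r ^ 2))).add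
    ((hasSum_poi_id r).mul_left (1 - 4 * r + 6 * r ^ 2 - 4 * r ^ 3))).add
    ((hasSum_poi r).mul_left (r ^ 4))) using 1
  · ext k; ring
  · ring

lemma HasSum.mul_pair {α β : Type*} {f : α → ℝ} {g : β → ℝ} {a b : ℝ}
    (hf : HasSum f a) (hg : HasSum g b) : HasSum (fun p : α × β => f p.1 * g p.2) (a * b) :=
  hf.mul hg (summable_mul_of_summable_norm hf.summable.norm hg.summable.norm)

lemma hasSum_fin_succ_pi {κ : Type*} {S : ℕ} {F : (Fin (S + 1) → κ) → ℝ} {a : ℝ}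
    (h : HasSum (fun p : κ × (Fin S → κ) => F (Fin.cons p.1 p.2)) a) : HasSum F a :=
  ((Fin.consEquiv (fun _ : Fin (S + 1) => κ)).hasSum_iff (f := F)).1 h

/-- A sum over tuples of a product of functions of single coordinates factorizes. -/
lemma hasSum_pi_prod {κ : Type*} {S : ℕ} {f : Fin S → κ → ℝ} {a : Fin S → ℝ}
    (h : ∀ i, HasSum (f i) (a i)) :
    HasSum (fun z : Fin S → κ => ∏ i, f i (z i)) (∏ i, a i) := by
  induction S with
  | zero => simp
  | succ S ih =>
    apply hasSum_fin_succ_pi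
    have := (h 0).mul_pair (ih (f := fun i => f i.succ) fun i => h i.succ)
    simpa [Fin.prod_univ_succ] using this

/-- First and second moments of a sum of independent random variables. -/
lemma hasSum_pi_moments {κ : Type*} {S : ℕ} {p X : Fin S → κ → ℝ} {m s : Fin S → ℝ}
    (hp : ∀ i, HasSum (p i) 1) (hm : ∀ i, HasSum (fun k => p i k * X i k) (m i))
    (hs : ∀ i, HasSum (fun k => p i k * X i k ^ 2) (s i)) :
    HasSum (fun z : Fin S → κ => (∏ i, p i (z i)) * ∑ i, X i (z i)) (∑ i, m i) ∧
    HasSum (fun z : Fin S → κ => (∏ i, p i (z i)) * (∑ i, X i (z i)) ^ 2)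
      (∑ i, (s i - m i ^ 2) + (∑ i, m i) ^ 2) := by
  induction S with
  | zero => constructor <;> simp
  | succ S ih =>
    obtain ⟨h1, h2⟩ := ih (p := fun i => p i.succ) (X := fun i => X i.succ)
      (fun i => hp i.succ) (fun i => hm i.succ) (fun i => hs i.succ)
    have h0 : HasSum (fun z : Fin S → κ => ∏ i, p i.succ (z i)) 1 := by
      simpa using hasSum_pi_prod (f := fun i => p i.succ) fun i => hp i.succ
    constructor
    · apply hasSum_fin_succ_pi
      convert ((hm 0).mul_pair h0).add ((hp 0).mul_pair h1) using 1
      · ext q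
        simp [Fin.prod_univ_succ, Fin.sum_univ_succ]
        ring
      · simp [Fin.sum_univ_succ]
    · apply hasSum_fin_succ_pi
      convert (((hs 0).mul_pair h0).add (((hm 0).mul_pair h1).mul_left 2)).add
        ((hp 0).mul_pair h2) using 1
      · ext q
        simp [Fin.prod_univ_succ, Fin.sum_univ_succ]
        ring
      · simp [Fin.sum_univ_succ]
        ring

/-- The Laguerre polynomial of degree `n`. -/
noncomputable def laguerre (n : ℕ) : Polynomial ℝ :=
  ∑ k ∈ Finset.range (n + 1),
    Polynomial.C ((-1) ^ k * (n.choose k : ℝ) / (Nat.factorial k : ℝ)) * Polynomial.X ^ k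

lemma coeff_laguerre (n k : ℕ) :
    (laguerre n).coeff k = (-1) ^ k * (n.choose k : ℝ) / (Nat.factorial k : ℝ) := by
  simp only [laguerre, Polynomial.finsetSum_coeff, Polynomial.coeff_C_mul, Polynomial.coeff_X_pow,
    mul_ite, mul_one, mul_zero, Finset.sum_ite_eq, Finset.mem_range]
  split_ifs with h
  · rfl
  · rw [Nat.choose_eq_zero_of_lt (by omega)]; simp

lemma eval_laguerre (n : ℕ) (x : ℝ) :
    (laguerre n).eval x = ∑ k ∈ Finset.range (n + 1),
      (-1) ^ k * (n.choose k : ℝ) / (Nat.factorial k : ℝ) * x ^ k := by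
  simp [laguerre, Polynomial.eval_finsetSum]

lemma derivative_laguerre_succ (n : ℕ) :
    Polynomial.derivative (laguerre (n + 1)) =
      Polynomial.derivative (laguerre n) - laguerre n := by
  ext k
  simp only [Polynomial.coeff_derivative, Polynomial.coeff_sub, coeff_laguerre,
    Nat.choose_succ_succ', Nat.factorial_succ]
  push_cast
  have : (Nat.factorial k : ℝ) ≠ 0 := by positivity
  have : (k : ℝ) + 1 ≠ 0 := by positivity
  field_simp
  ring

lemma X_mul_derivative_laguerre_succ (n : ℕ) :
    Polynomial.X * Polynomial.derivative (laguerre (n + 1)) =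
      Polynomial.C ((n : ℝ) + 1) * (laguerre (n + 1) - laguerre n) := by
  ext k
  rcases k with _ | k
  · simp [coeff_laguerre]
  · simp only [Polynomial.coeff_X_mul, Polynomial.coeff_derivative, Polynomial.coeff_C_mul,
      Polynomial.coeff_sub, coeff_laguerre]
    have h1 : ((n : ℝ) + 1) * (n.choose k : ℝ) = ((n + 1).choose (k + 1) : ℝ) * ((k : ℝ) + 1) := by
      exact_mod_cast Nat.add_one_mul_choose_eq n k
    have h2 : ((n + 1).choose (k + 1) : ℝ) = (n.choose k : ℝ) + (n.choose (k + 1) : ℝ) := by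
      exact_mod_cast Nat.choose_succ_succ' n k
    have h3 : ((n + 1).choose (k + 1) : ℝ) - (n.choose (k + 1) : ℝ) = n.choose k := by
      rw [h2]; ring
    calc _ = (-1) ^ (k + 1) / ((k + 1).factorial : ℝ)
          * (((n + 1).choose (k + 1) : ℝ) * ((k : ℝ) + 1)) := by ring
      _ = (-1) ^ (k + 1) / ((k + 1).factorial : ℝ)
          * (((n : ℝ) + 1) * (((n + 1).choose (k + 1) : ℝ) - (n.choose (k + 1) : ℝ))) := by
          rw [← h1, h3]
      _ = _ := by ring

/-- Laguerre's differential equation. -/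
lemma laguerre_ode (n : ℕ) (x : ℝ) :
    x * (Polynomial.derivative (Polynomial.derivative (laguerre (n + 1)))).eval x =
      (x - 1) * (Polynomial.derivative (laguerre (n + 1))).eval x
        - (n + 1) * (laguerre (n + 1)).eval x := by
  have h2 := X_mul_derivative_laguerre_succ n
  have h1 := derivative_laguerre_succ n
  have h3 := congrArg (fun p => (Polynomial.derivative p).eval x) h2
  have h4 := congrArg (fun p => p.eval x) h2
  have h5 := congrArg (fun p => p.eval x) h1
  simp at h3 h4 h5
  linear_combination h3 - h4 + (n + 1 : ℝ) * h5

lemma laguerre_eval_zero (n : ℕ) : (laguerre n).eval 0 = 1 := by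
  rw [← Polynomial.coeff_zero_eq_eval_zero, coeff_laguerre]; simp

lemma abs_eval_laguerre_le (n : ℕ) {x : ℝ} (hx : 0 ≤ x) :
    |(laguerre n).eval x| ≤ Real.exp x := by
  rcases n with _ | n
  · simp [eval_laguerre, hx]
  set u := laguerre (n + 1) with hu
  have hn : (0 : ℝ) < (n : ℝ) + 1 := by positivity
  let E : ℝ → ℝ := fun y => Real.exp (-2 * y) *
    (u.eval y ^ 2 + y / (n + 1) * (Polynomial.derivative u).eval y ^ 2)
  have hE : ∀ y, HasDerivAt E (Real.exp (-2 * y) *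
      (-2 * u.eval y ^ 2 - 1 / (n + 1) * (Polynomial.derivative u).eval y ^ 2)) y := by
    intro y
    have d0 : HasDerivAt (fun y : ℝ => Real.exp (-2 * y)) (Real.exp (-2 * y) * (-2)) y := by
      simpa using ((hasDerivAt_id y).const_mul (-2 : ℝ)).exp
    have d1 := (u.hasDerivAt y).pow 2
    have d2 := (((hasDerivAt_id y).div_const ((n : ℝ) + 1)).mul
      (((Polynomial.derivative u).hasDerivAt y).pow 2))
    refine (d0.mul (d1.add d2)).congr_deriv ?_
    have ode := laguerre_ode n y
    rw [← hu] at ode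
    simp only [id, Pi.add_apply, Pi.mul_apply, Pi.pow_apply]
    field_simp
    linear_combination 2 * (Polynomial.derivative u).eval y * ode
  have hanti : AntitoneOn E (Set.Ici 0) := by
    apply antitoneOn_of_deriv_nonpos (convex_Ici 0)
    · exact fun y _ => (hE y).continuousAt.continuousWithinAt
    · exact fun y _ => (hE y).differentiableAt.differentiableWithinAt
    · intro y _
      rw [(hE y).deriv]
      have : 0 ≤ 1 / ((n : ℝ) + 1) * (Polynomial.derivative u).eval y ^ 2 := by positivity
      have h2 : -2 * u.eval y ^ 2 - 1 / (n + 1) * (Polynomial.derivative u).eval y ^ 2 ≤ 0 := by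
        nlinarith [sq_nonneg (u.eval y)]
      exact mul_nonpos_of_nonneg_of_nonpos (Real.exp_pos _).le h2
  have h := hanti (Set.mem_Ici.2 le_rfl) (Set.mem_Ici.2 hx) hx
  have h0 : E 0 = 1 := by simp [E, hu, laguerre_eval_zero]
  rw [h0] at h
  have h1 : Real.exp (-2 * x) * u.eval x ^ 2 ≤ 1 := by
    refine le_trans ?_ h
    apply mul_le_mul_of_nonneg_left _ (Real.exp_pos _).le
    have : 0 ≤ x / (n + 1) * (Polynomial.derivative u).eval x ^ 2 := by positivity
    linarith
  apply abs_le_of_sq_le_sq _ (Real.exp_pos _).le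
  have h2 : Real.exp (-2 * x) * Real.exp x ^ 2 = 1 := by
    rw [← Real.exp_nat_mul, ← Real.exp_add]; norm_num
  have h3 : Real.exp (-2 * x) > 0 := Real.exp_pos _
  nlinarith

/-- The Laguerre function `exp (-x) * Lₙ(x)`. -/
noncomputable def laguerreFun (n : ℕ) (x : ℝ) : ℝ := Real.exp (-x) * (laguerre n).eval x

/-- The derivative of `laguerreFun`. -/
noncomputable def laguerreFunDeriv (n : ℕ) (x : ℝ) : ℝ :=
  Real.exp (-x) * ((Polynomial.derivative (laguerre n)).eval x - (laguerre n).eval x)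

lemma hasDerivAt_laguerreFun (n : ℕ) (x : ℝ) :
    HasDerivAt (laguerreFun n) (laguerreFunDeriv n x) x := by
  have h := ((hasDerivAt_neg x).exp).mul ((laguerre n).hasDerivAt x)
  refine h.congr_deriv ?_
  simp only [laguerreFunDeriv]
  ring

lemma laguerreFunDeriv_succ (n : ℕ) (x : ℝ) :
    laguerreFunDeriv (n + 1) x = laguerreFunDeriv n x - laguerreFun (n + 1) x := by
  simp only [laguerreFunDeriv, laguerreFun, derivative_laguerre_succ, Polynomial.eval_sub]
  ring

lemma mul_laguerreFunDeriv (n : ℕ) (x : ℝ) :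
    x * laguerreFunDeriv n x = (n + 1) * (laguerreFun (n + 1) x - laguerreFun n x) := by
  have h := congrArg (fun p => p.eval x) (X_mul_derivative_laguerre_succ n)
  simp [derivative_laguerre_succ] at h
  simp only [laguerreFunDeriv, laguerreFun]
  linear_combination Real.exp (-x) * h

lemma abs_laguerreFun_le (n : ℕ) {x : ℝ} (hx : 0 ≤ x) : |laguerreFun n x| ≤ 1 := by
  rw [laguerreFun, abs_mul, Real.abs_exp]
  calc _ ≤ Real.exp (-x) * Real.exp x :=
        mul_le_mul_of_nonneg_left (abs_eval_laguerre_le n hx) (Real.exp_pos _).le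
    _ = 1 := by rw [← Real.exp_add]; simp

lemma tendsto_laguerreFun (n : ℕ) :
    Filter.Tendsto (laguerreFun n) Filter.atTop (nhds 0) := by
  have h : laguerreFun n = fun x => ∑ k ∈ Finset.range (n + 1),
      (-1) ^ k * (n.choose k : ℝ) / (Nat.factorial k : ℝ) * (x ^ k * Real.exp (-x)) := by
    ext x
    rw [laguerreFun, eval_laguerre, Finset.mul_sum]
    exact Finset.sum_congr rfl fun k _ => by ring
  rw [h, show (0 : ℝ) = ∑ k ∈ Finset.range (n + 1),
      (-1) ^ k * (n.choose k : ℝ) / (Nat.factorial k : ℝ) * 0 by simp]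
  exact tendsto_finsetSum _ fun k _ =>
    (Real.tendsto_pow_mul_exp_neg_atTop_nhds_zero k).const_mul _

lemma hasSum_poi_choose (j : ℕ) (x : ℝ) :
    HasSum (fun k : ℕ => poi x k * ((-1) ^ k * (j.choose k : ℝ))) (laguerreFun j x) := by
  have h : laguerreFun j x =
      ∑ k ∈ Finset.range (j + 1), poi x k * ((-1) ^ k * (j.choose k : ℝ)) := by
    rw [laguerreFun, eval_laguerre, Finset.mul_sum]
    exact Finset.sum_congr rfl fun k _ => by rw [poi]; ring
  rw [h]
  apply hasSum_sum_of_ne_finset_zero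
  intro k hk
  rw [Nat.choose_eq_zero_of_lt (by simpa using hk)]
  simp

lemma laguerreFun_zero (x : ℝ) : laguerreFun 0 x = Real.exp (-x) := by
  simp [laguerreFun, eval_laguerre]

/-- Averaged partial sums of `∑ Lⱼ(x) exp (-x) / (j + 1)`. -/
noncomputable def laguerreMean (K : ℕ) (x : ℝ) : ℝ :=
  (∑ i ∈ Finset.range K, ∑ j ∈ Finset.range (K + 1 + i), laguerreFun j x / (j + 1)) / K

lemma hasDerivAt_laguerreMean {K : ℕ} (hK : 0 < K) {x : ℝ} (hx : 0 < x) :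
    HasDerivAt (laguerreMean K)
      (((laguerreFunDeriv K x - laguerreFunDeriv (2 * K) x) / K - Real.exp (-x)) / x) x := by
  have hU : ∀ m : ℕ, HasDerivAt (fun y => ∑ j ∈ Finset.range m, laguerreFun j y / (j + 1))
      ((laguerreFun m x - Real.exp (-x)) / x) x := by
    intro m
    have h := HasDerivAt.fun_sum (u := Finset.range m) fun j _ =>
      (hasDerivAt_laguerreFun j x).div_const ((j : ℝ) + 1)
    refine h.congr_deriv ?_
    rw [eq_div_iff hx.ne', Finset.sum_mul, ← laguerreFun_zero,
      ← Finset.sum_range_sub (fun j => laguerreFun j x) m]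
    refine Finset.sum_congr rfl fun j _ => ?_
    have := mul_laguerreFunDeriv j x
    have hj : (j : ℝ) + 1 ≠ 0 := by positivity
    field_simp
    linear_combination this
  have hsum : ∀ k : ℕ, ∑ i ∈ Finset.range k, laguerreFun (K + 1 + i) x =
      laguerreFunDeriv K x - laguerreFunDeriv (K + k) x := by
    intro k
    induction k with
    | zero => simp
    | succ k ih =>
      rw [Finset.sum_range_succ, ih, show K + (k + 1) = (K + k) + 1 by ring,
        laguerreFunDeriv_succ, show K + 1 + k = K + k + 1 by ring]
      ring
  have h := (HasDerivAt.fun_sum (u := Finset.range K) fun i _ => hU (K + 1 + i)).div_const (K : ℝ)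
  refine h.congr_deriv ?_
  rw [← Finset.sum_div, Finset.sum_sub_distrib, hsum K, ← two_mul]
  have hK' : (K : ℝ) ≠ 0 := by positivity
  simp
  field_simp

/-- The Poisson expectation of the harmonic numbers. -/
noncomputable def harmonicMean (x : ℝ) : ℝ := ∑' k : ℕ, poi x k * (harmonic k : ℝ)

lemma harmonic_nonneg_le (k : ℕ) : 0 ≤ (harmonic k : ℝ) ∧ (harmonic k : ℝ) ≤ k := by
  induction k with
  | zero => simp
  | succ k ih =>
    rw [harmonic_succ]
    push_cast
    have h1 : ((k : ℝ) + 1)⁻¹ ≤ 1 :=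
      inv_le_one_of_one_le₀ (by linarith [Nat.cast_nonneg (α := ℝ) k])
    have h2 : 0 ≤ ((k : ℝ) + 1)⁻¹ := by positivity
    constructor <;> linarith

lemma hasSum_harmonicMean {x : ℝ} (hx : 0 ≤ x) :
    HasSum (fun k : ℕ => poi x k * (harmonic k : ℝ)) (harmonicMean x) := by
  refine (Summable.of_nonneg_of_le (fun k => ?_) (fun k => ?_) (hasSum_poi_id x).summable).hasSum
  · exact mul_nonneg (poi_nonneg hx k) (harmonic_nonneg_le k).1
  · exact mul_le_mul_of_nonneg_left (harmonic_nonneg_le k).2 (poi_nonneg hx k)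

lemma hasDerivAt_harmonicMean {x : ℝ} (hx : 0 < x) :
    HasDerivAt harmonicMean ((1 - Real.exp (-x)) / x) x := by
  set r := x + 1 with hr
  have hr0 : 0 < r := by linarith
  set g : ℕ → ℝ → ℝ := fun k y => (harmonic k : ℝ) * y ^ k / (Nat.factorial k : ℝ)
  set g' : ℕ → ℝ → ℝ := fun k y =>
    (harmonic k : ℝ) * ((k : ℝ) * y ^ (k - 1)) / (Nat.factorial k : ℝ)
  have hu : Summable fun k : ℕ => (poi r k * (k : ℝ) ^ 2) * (Real.exp r / r) :=
    (hasSum_poi_sq r).summable.mul_right _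
  have hg0 : HasSum (fun k => g k x) (Real.exp x * harmonicMean x) := by
    refine ((hasSum_harmonicMean hx.le).mul_left (Real.exp x)).congr_fun fun k => ?_
    simp only [g, poi, Real.exp_neg]
    have := Real.exp_pos x
    field_simp
  have hd := hasDerivAt_tsum_of_isPreconnected (g := g) (g' := g') (t := Set.Ioo 0 r)
    (y₀ := x) (y := x) hu isOpen_Ioo isPreconnected_Ioo
    (fun k y _ => by
      exact ((hasDerivAt_pow k y).const_mul (harmonic k : ℝ)).div_const _)
    (fun k y hy => by
      rcases k with _ | k
      · simp [g']
      have hk := harmonic_nonneg_le (k + 1)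
      have hpos : 0 ≤ g' (k + 1) y := by
        have := hy.1
        have := hk.1
        simp only [g']
        positivity
      rw [Real.norm_of_nonneg hpos]
      have hy' : y ^ k ≤ r ^ k := pow_le_pow_left₀ hy.1.le hy.2.le k
      have e : poi r (k + 1) * ((k + 1 : ℕ) : ℝ) ^ 2 * (Real.exp r / r) =
          ((k + 1 : ℕ) : ℝ) * (((k + 1 : ℕ) : ℝ) * r ^ k) / ((k + 1).factorial : ℝ) := by
        simp only [poi, Real.exp_neg]
        have := Real.exp_pos r
        field_simp
        ring
      rw [e]
      simp only [g', Nat.add_sub_cancel]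
      gcongr
      · have := hy.1
        positivity
      · exact hk.2)
    ⟨hx, by linarith⟩ hg0.summable ⟨hx, by linarith⟩
  have hg' : HasSum (fun k => g' k x) (Real.exp x * harmonicMean x + (Real.exp x - 1) / x) := by
    rw [← hasSum_nat_add_iff' 1]
    have h1 : HasSum (fun k : ℕ => x ^ (k + 1) / ((k + 1).factorial : ℝ)) (Real.exp x - 1) := by
      have := (hasSum_nat_add_iff' 1).2 (hasSum_pow_div_factorial x)
      simpa using this
    have h2 : Real.exp x * harmonicMean x + (Real.exp x - 1) / x
        - ∑ i ∈ Finset.range 1, g' i x =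
        Real.exp x * harmonicMean x + (Real.exp x - 1) / x := by simp [g']
    rw [h2]
    refine (hg0.add (h1.div_const x)).congr_fun fun k => ?_
    simp only [g, g', harmonic_succ, Nat.factorial_succ, Nat.add_sub_cancel]
    push_cast
    have : (Nat.factorial k : ℝ) ≠ 0 := by positivity
    have : (k : ℝ) + 1 ≠ 0 := by positivity
    field_simp
    ring
  rw [hg'.tsum_eq] at hd
  have hfun : harmonicMean = fun y => Real.exp (-y) * ∑' k, g k y := by
    ext y
    rw [harmonicMean, ← tsum_mul_left]
    refine tsum_congr fun k => ?_
    simp only [g, poi]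
    ring
  have hd2 := ((hasDerivAt_neg x).exp).mul hd
  rw [hg0.tsum_eq] at hd2
  rw [hfun]
  refine hd2.congr_deriv ?_
  simp only [Real.exp_neg]
  have := Real.exp_pos x
  field_simp
  ring

lemma abs_harmonicMean_sub_le {x : ℝ} (hx : 0 < x) :
    |harmonicMean x - Real.eulerMascheroniConstant - Real.log x| ≤ 1 / x := by
  set γ := Real.eulerMascheroniConstant with hγ
  have hE : HasSum (fun k : ℕ => poi x k * ((harmonic k : ℝ) - γ)) (harmonicMean x - γ) := by
    have h := (hasSum_harmonicMean hx.le).sub ((hasSum_poi x).mul_right γ)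
    rw [one_mul] at h
    exact h.congr_fun fun k => mul_sub _ _ _
  have hupper : harmonicMean x - γ ≤ Real.log (x + 1) := by
    have h2 : HasSum (fun k : ℕ => poi x k * (Real.log (x + 1) + ((k : ℝ) - x) / (x + 1)))
        (Real.log (x + 1)) := by
      have h := ((hasSum_poi x).mul_right (Real.log (x + 1) - x / (x + 1))).add
        ((hasSum_poi_id x).mul_right (1 / (x + 1)))
      have e : 1 * (Real.log (x + 1) - x / (x + 1)) + x * (1 / (x + 1)) = Real.log (x + 1) := by
        ring
      rw [e] at h
      exact h.congr_fun fun k => by ring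
    refine hasSum_le (fun k => mul_le_mul_of_nonneg_left ?_ (poi_nonneg hx.le k)) hE h2
    have h3 : (harmonic k : ℝ) - Real.log (k + 1) < γ :=
      Real.eulerMascheroniSeq_lt_eulerMascheroniConstant k
    have hk : (0 : ℝ) < (k : ℝ) + 1 := by positivity
    have h4 := Real.log_le_sub_one_of_pos (x := ((k : ℝ) + 1) / (x + 1)) (by positivity)
    rw [Real.log_div hk.ne' (by positivity)] at h4
    have e : ((k : ℝ) + 1) / (x + 1) - 1 = ((k : ℝ) - x) / (x + 1) := by
      field_simp
      ring
    linarith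
  have hlower : x * Real.log x - 1 ≤ x * (harmonicMean x - γ) := by
    have h2 : HasSum (fun k : ℕ => poi x k * ((k : ℝ) * Real.log x + ((k : ℝ) - x) - 1))
        (x * Real.log x - 1) := by
      have h := ((hasSum_poi_id x).mul_right (Real.log x + 1)).sub
        ((hasSum_poi x).mul_right (x + 1))
      have e : x * (Real.log x + 1) - 1 * (x + 1) = x * Real.log x - 1 := by ring
      rw [e] at h
      exact h.congr_fun fun k => by ring
    refine hasSum_le (fun k => mul_le_mul_of_nonneg_left ?_ (poi_nonneg hx.le k)) h2
      (hasSum_poi_shift hE)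
    rcases k with _ | k
    · simp
      linarith
    have h3 : γ < (harmonic (k + 1) : ℝ) - Real.log ((k + 1 : ℕ) : ℝ) := by
      have := Real.eulerMascheroniConstant_lt_eulerMascheroniSeq' (k + 1)
      simpa [Real.eulerMascheroniSeq'] using this
    rw [harmonic_succ, Nat.add_sub_cancel] at *
    push_cast at *
    have hk : (0 : ℝ) < (k : ℝ) + 1 := by positivity
    have h4 := Real.log_le_sub_one_of_pos (x := x / ((k : ℝ) + 1)) (by positivity)
    rw [Real.log_div hx.ne' hk.ne'] at h4
    have h5 := mul_le_mul_of_nonneg_left h4 hk.le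
    have h6 := mul_le_mul_of_nonneg_left h3.le hk.le
    have e1 : ((k : ℝ) + 1) * (x / ((k : ℝ) + 1) - 1) = x - (k + 1) := by field_simp
    have e2 : ((k : ℝ) + 1) * ((harmonic k : ℝ) + ((k : ℝ) + 1)⁻¹ - Real.log (k + 1)) =
      (k + 1) * (harmonic k - Real.log (k + 1)) + 1 := by field_simp; ring
    rw [e1] at h5
    rw [e2] at h6
    nlinarith
  have hlog : Real.log (x + 1) ≤ Real.log x + 1 / x := by
    have h4 := Real.log_le_sub_one_of_pos (x := (x + 1) / x) (by positivity)
    rw [Real.log_div (by positivity) hx.ne'] at h4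
    have e : (x + 1) / x - 1 = 1 / x := by field_simp; ring
    linarith
  rw [abs_le]
  constructor
  · have : Real.log x - 1 / x ≤ harmonicMean x - γ := by
      have h : x * (Real.log x - 1 / x) ≤ x * (harmonicMean x - γ) := by
        have e : x * (Real.log x - 1 / x) = x * Real.log x - 1 := by field_simp
        rw [e]; exact hlower
      exact le_of_mul_le_mul_left h hx
    linarith
  · linarith

/-- The bias of the polynomially corrected estimator of the logarithm. -/
noncomputable def logBias (K : ℕ) (x : ℝ) : ℝ :=
  harmonicMean x - Real.eulerMascheroniConstant - laguerreMean K x - Real.log x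

lemma tendsto_laguerreMean (K : ℕ) : Filter.Tendsto (laguerreMean K) Filter.atTop (nhds 0) := by
  have h : Filter.Tendsto (fun x => (∑ i ∈ Finset.range K, ∑ j ∈ Finset.range (K + 1 + i),
      laguerreFun j x / ((j : ℝ) + 1)) / K) Filter.atTop
      (nhds ((∑ i ∈ Finset.range K,
        ∑ j ∈ Finset.range (K + 1 + i), (0 : ℝ) / ((j : ℝ) + 1)) / K)) :=
    (tendsto_finsetSum _ fun i _ => tendsto_finsetSum _ fun j _ =>
      (tendsto_laguerreFun j).div_const _).div_const _
  simp only [zero_div, Finset.sum_const_zero] at h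
  exact h

lemma tendsto_logBias (K : ℕ) : Filter.Tendsto (logBias K) Filter.atTop (nhds 0) := by
  have h1 : Filter.Tendsto
      (fun x => harmonicMean x - Real.eulerMascheroniConstant - Real.log x) Filter.atTop
      (nhds 0) := by
    refine squeeze_zero_norm' (a := fun x : ℝ => 1 / x) ?_
      (by simpa using tendsto_inv_atTop_zero (𝕜 := ℝ))
    filter_upwards [Filter.eventually_gt_atTop 0] with x hx
    exact abs_harmonicMean_sub_le hx
  have := h1.sub (tendsto_laguerreMean K)
  rw [sub_zero] at this
  refine this.congr fun x => ?_
  simp only [logBias]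
  ring

lemma hasDerivAt_logBias {K : ℕ} (hK : 0 < K) {x : ℝ} (hx : 0 < x) :
    HasDerivAt (logBias K)
      ((laguerreFunDeriv (2 * K) x - laguerreFunDeriv K x) / (K * x)) x := by
  have h := (((hasDerivAt_harmonicMean hx).sub_const Real.eulerMascheroniConstant).sub
    (hasDerivAt_laguerreMean hK hx)).sub (Real.hasDerivAt_log hx.ne')
  refine h.congr_deriv ?_
  have hK' : (K : ℝ) ≠ 0 := by positivity
  field_simp
  ring

lemma abs_mul_logBias_le {K : ℕ} (hK : 0 < K) {x : ℝ} (hx : 0 < x) :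
    |x * logBias K x| ≤ 4 / K := by
  have hK' : (0 : ℝ) < K := by positivity
  set D : ℝ → ℝ := fun y => laguerreFun (2 * K) y - laguerreFun K y with hD
  have hDle : ∀ y, 0 ≤ y → |D y| ≤ 2 := fun y hy => by
    have h1 := abs_laguerreFun_le (2 * K) hy
    have h2 := abs_laguerreFun_le K hy
    have := abs_sub (laguerreFun (2 * K) y) (laguerreFun K y)
    simp only [hD]
    linarith
  set Ψ : ℝ → ℝ := fun y => logBias K y - D y / (K * y) with hΨ
  have hΨd : ∀ y, 0 < y → HasDerivAt Ψ (D y / (K * y ^ 2)) y := fun y hy => by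
    have h1 := (hasDerivAt_laguerreFun (2 * K) y).sub (hasDerivAt_laguerreFun K y)
    have h2 := h1.div ((hasDerivAt_id y).const_mul (K : ℝ)) 
      (mul_pos hK' hy).ne'
    refine ((hasDerivAt_logBias hK hy).sub h2).congr_deriv ?_
    simp only [hD, id, Pi.sub_apply]
    field_simp
    ring
  have hDt : Filter.Tendsto (fun y => D y / (K * y)) Filter.atTop (nhds 0) := by
    refine squeeze_zero_norm' (a := fun y : ℝ => 2 / K * y⁻¹) ?_
      (by simpa using (tendsto_inv_atTop_zero (𝕜 := ℝ)).const_mul (2 / (K : ℝ)))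
    filter_upwards [Filter.eventually_gt_atTop 0] with y hy
    rw [Real.norm_eq_abs, abs_div, abs_of_pos (by positivity : (0 : ℝ) < K * y)]
    calc |D y| / (K * y) ≤ 2 / (K * y) := by gcongr; exact hDle y hy.le
      _ = 2 / K * y⁻¹ := by field_simp
  have hΨt : Filter.Tendsto Ψ Filter.atTop (nhds 0) := by
    simpa using (tendsto_logBias K).sub hDt
  have hinv : Filter.Tendsto (fun y : ℝ => 2 / K * y⁻¹) Filter.atTop (nhds 0) := by
    simpa using (tendsto_inv_atTop_zero (𝕜 := ℝ)).const_mul (2 / (K : ℝ))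
  have hinvd : ∀ y : ℝ, 0 < y → HasDerivAt (fun y : ℝ => 2 / K * y⁻¹) (-(2 / (K * y ^ 2))) y :=
    fun y hy => by
      refine ((hasDerivAt_inv hy.ne').const_mul (2 / (K : ℝ))).congr_deriv ?_
      field_simp
  have hDy : ∀ y : ℝ, 0 < y → |D y / (K * y ^ 2)| ≤ 2 / (K * y ^ 2) := fun y hy => by
    rw [abs_div, abs_of_pos (by positivity : (0 : ℝ) < K * y ^ 2)]
    gcongr
    exact hDle y hy.le
  have hupper : Ψ x ≤ 2 / K * x⁻¹ := by
    have hmono : MonotoneOn (fun y => Ψ y - 2 / K * y⁻¹) (Set.Ici x) := by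
      refine monotoneOn_of_hasDerivWithinAt_nonneg (convex_Ici x)
        (f' := fun y => D y / (K * y ^ 2) - -(2 / (K * y ^ 2))) ?_ ?_ ?_
      · intro y hy
        have hy' : 0 < y := hx.trans_le hy
        exact ((hΨd y hy').sub (hinvd y hy')).continuousAt.continuousWithinAt
      · intro y hy
        rw [interior_Ici] at hy
        have hy' : 0 < y := hx.trans hy
        exact ((hΨd y hy').sub (hinvd y hy')).hasDerivWithinAt
      · intro y hy
        rw [interior_Ici] at hy
        have := (abs_le.1 (hDy y (hx.trans hy))).1
        linarith
    have ht : Filter.Tendsto (fun y => Ψ y - 2 / K * y⁻¹) Filter.atTop (nhds 0) := by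
      simpa using hΨt.sub hinv
    have := ge_of_tendsto ht (b := Ψ x - 2 / K * x⁻¹) (by
      filter_upwards [Filter.eventually_ge_atTop x] with y hy
      exact hmono (Set.mem_Ici.2 le_rfl) hy hy)
    linarith
  have hlower : -(2 / K * x⁻¹) ≤ Ψ x := by
    have hanti : AntitoneOn (fun y => Ψ y + 2 / K * y⁻¹) (Set.Ici x) := by
      refine antitoneOn_of_hasDerivWithinAt_nonpos (convex_Ici x)
        (f' := fun y => D y / (K * y ^ 2) + -(2 / (K * y ^ 2))) ?_ ?_ ?_
      · intro y hy
        have hy' : 0 < y := hx.trans_le hy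
        exact ((hΨd y hy').add (hinvd y hy')).continuousAt.continuousWithinAt
      · intro y hy
        rw [interior_Ici] at hy
        have hy' : 0 < y := hx.trans hy
        exact ((hΨd y hy').add (hinvd y hy')).hasDerivWithinAt
      · intro y hy
        rw [interior_Ici] at hy
        have := (abs_le.1 (hDy y (hx.trans hy))).2
        linarith
    have ht : Filter.Tendsto (fun y => Ψ y + 2 / K * y⁻¹) Filter.atTop (nhds 0) := by
      simpa using hΨt.add hinv
    have := le_of_tendsto ht (b := Ψ x + 2 / K * x⁻¹) (by
      filter_upwards [Filter.eventually_ge_atTop x] with y hy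
      exact hanti (Set.mem_Ici.2 le_rfl) hy hy)
    linarith
  have e : x * logBias K x = x * Ψ x + D x / K := by
    simp only [hΨ]
    field_simp
    ring
  rw [e]
  have h1 : |x * Ψ x| ≤ 2 / K := by
    rw [abs_mul, abs_of_pos hx]
    calc x * |Ψ x| ≤ x * (2 / K * x⁻¹) := by gcongr; exact abs_le.2 ⟨hlower, hupper⟩
      _ = 2 / K := by field_simp
  have h2 : |D x / K| ≤ 2 / K := by
    rw [abs_div, abs_of_pos hK']
    gcongr
    exact hDle x hx.le
  calc _ ≤ |x * Ψ x| + |D x / K| := abs_add_le _ _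
    _ ≤ 2 / K + 2 / K := add_le_add h1 h2
    _ = 4 / K := by ring

lemma poissonPMF_eq_prod_poi (S : ℕ) (lam : ℝ) (P : Fin S → ℝ) (z : Fin S → ℕ) :
    poissonPMF S lam P z = ∏ i, poi (lam * P i) (z i) := rfl

/-- The function of the counts whose Poisson expectation is `laguerreMean K`. -/
noncomputable def biasCorrection (K z : ℕ) : ℝ :=
  (∑ i ∈ Finset.range K, ∑ j ∈ Finset.range (K + 1 + i),
    (-1) ^ z * (j.choose z : ℝ) / (j + 1)) / K

lemma hasSum_biasCorrection (K : ℕ) (x : ℝ) :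
    HasSum (fun z : ℕ => poi x z * biasCorrection K z) (laguerreMean K x) := by
  have h : HasSum (fun z : ℕ => (∑ i ∈ Finset.range K, ∑ j ∈ Finset.range (K + 1 + i),
      poi x z * ((-1) ^ z * (j.choose z : ℝ)) / ((j : ℝ) + 1)) / K) (laguerreMean K x) :=
    (hasSum_sum fun i _ => hasSum_sum fun j _ =>
      (hasSum_poi_choose j x).div_const ((j : ℝ) + 1)).div_const (K : ℝ)
  refine h.congr_fun fun z => ?_
  rw [biasCorrection, ← mul_div_assoc, Finset.mul_sum]
  congr 1
  refine Finset.sum_congr rfl fun i _ => ?_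
  rw [Finset.mul_sum]
  exact Finset.sum_congr rfl fun j _ => by ring

lemma abs_mul_biasCorrection_le {K : ℕ} (hK : 0 < K) (z : ℕ) :
    |(z : ℝ) * biasCorrection K (z - 1)| ≤ 4 ^ K := by
  rcases z with _ | z
  · simp
  have hK' : (0 : ℝ) < K := by positivity
  rw [biasCorrection, Nat.add_sub_cancel, ← mul_div_assoc, abs_div, abs_of_pos hK', div_le_iff₀ hK',
    Finset.mul_sum]
  calc |∑ i ∈ Finset.range K, ((z + 1 : ℕ) : ℝ) * ∑ j ∈ Finset.range (K + 1 + i),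
        (-1) ^ z * (j.choose z : ℝ) / ((j : ℝ) + 1)|
      ≤ ∑ i ∈ Finset.range K, |((z + 1 : ℕ) : ℝ) * ∑ j ∈ Finset.range (K + 1 + i),
        (-1) ^ z * (j.choose z : ℝ) / ((j : ℝ) + 1)| := Finset.abs_sum_le_sum_abs _ _
    _ ≤ ∑ i ∈ Finset.range K, (4 : ℝ) ^ K := by
        refine Finset.sum_le_sum fun i hi => ?_
        rw [Finset.mul_sum]
        have hterm : ∀ j ∈ Finset.range (K + 1 + i),
            |((z + 1 : ℕ) : ℝ) * ((-1) ^ z * (j.choose z : ℝ) / ((j : ℝ) + 1))| ≤ 2 ^ j := by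
          intro j _
          have hj : (0 : ℝ) < (j : ℝ) + 1 := by positivity
          rw [abs_mul, abs_div, abs_mul, abs_pow, abs_neg, abs_one, one_pow, one_mul,
            abs_of_pos hj, Nat.abs_cast, Nat.abs_cast]
          rcases lt_or_ge j z with hjz | hjz
          · rw [Nat.choose_eq_zero_of_lt hjz]
            simp
          · have h1 : (j.choose z : ℝ) ≤ 2 ^ j := by exact_mod_cast Nat.choose_le_two_pow j z
            have h2 : ((z + 1 : ℕ) : ℝ) ≤ (j : ℝ) + 1 := by push_cast; gcongr
            rw [← mul_div_assoc, div_le_iff₀ hj, mul_comm]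
            gcongr
        calc _ ≤ ∑ j ∈ Finset.range (K + 1 + i), (2 : ℝ) ^ j :=
              (Finset.abs_sum_le_sum_abs _ _).trans (Finset.sum_le_sum hterm)
          _ ≤ 2 ^ (K + 1 + i) := by
              rw [geom_sum_eq (by norm_num)]
              have : (0 : ℝ) < 2 ^ (K + 1 + i) := by positivity
              linarith
          _ ≤ 2 ^ (2 * K) := by
              have := Finset.mem_range.1 hi
              exact pow_le_pow_right₀ (by norm_num) (by omega)
          _ = 4 ^ K := by rw [pow_mul]; norm_num
    _ = 4 ^ K * K := by simp [mul_comm]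

/-- The uncorrected coordinatewise estimator of `r log (r / n)`, with `L = log n`. -/
noncomputable def harmonicEst (L : ℝ) (z : ℕ) : ℝ :=
  z * ((harmonic (z - 1) : ℝ) - Real.eulerMascheroniConstant - L)

lemma abs_harmonicEst_sub_le (L : ℝ) (z : ℕ) :
    |harmonicEst L z - z * (Real.log z - L)| ≤ 1 := by
  rcases z with _ | z
  · simp [harmonicEst]
  have h1 : (harmonic z : ℝ) - Real.log (z + 1) < Real.eulerMascheroniConstant :=
    Real.eulerMascheroniSeq_lt_eulerMascheroniConstant z
  have h2 : Real.eulerMascheroniConstant <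
      (harmonic z : ℝ) + ((z : ℝ) + 1)⁻¹ - Real.log (z + 1) := by
    have := Real.eulerMascheroniConstant_lt_eulerMascheroniSeq' (z + 1)
    simpa [Real.eulerMascheroniSeq', harmonic_succ] using this
  have hz : (0 : ℝ) < (z : ℝ) + 1 := by positivity
  have e : harmonicEst L (z + 1) - ((z + 1 : ℕ) : ℝ) * (Real.log ((z + 1 : ℕ) : ℝ) - L) =
      ((z : ℝ) + 1) * (harmonic z - Real.log (z + 1) - Real.eulerMascheroniConstant) := by
    rw [harmonicEst, Nat.add_sub_cancel]
    push_cast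
    ring
  rw [e, abs_mul, abs_of_pos hz]
  have h3 : |(harmonic z : ℝ) - Real.log (z + 1) - Real.eulerMascheroniConstant| ≤
      ((z : ℝ) + 1)⁻¹ := by
    rw [abs_le]
    have : 0 < ((z : ℝ) + 1)⁻¹ := by positivity
    constructor <;> linarith
  calc _ ≤ ((z : ℝ) + 1) * ((z : ℝ) + 1)⁻¹ := mul_le_mul_of_nonneg_left h3 hz.le
    _ = 1 := mul_inv_cancel₀ hz.ne'

lemma abs_harmonicEst_sub_target_le {r : ℝ} (hr : 0 < r) (L : ℝ) (z : ℕ) :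
    |harmonicEst L z - r * (Real.log r - L)| ≤
      1 + |(z : ℝ) - r| + ((z : ℝ) - r) ^ 2 / r + |(z : ℝ) - r| * |Real.log r - L| := by
  have h1 := abs_harmonicEst_sub_le L z
  have h2 : |(z : ℝ) * (Real.log z - Real.log r)| ≤ |(z : ℝ) - r| + ((z : ℝ) - r) ^ 2 / r := by
    rcases Nat.eq_zero_or_pos z with rfl | hz
    · simp
      positivity
    have hz' : (0 : ℝ) < z := by exact_mod_cast hz
    have h3 := Real.log_le_sub_one_of_pos (x := (z : ℝ) / r) (by positivity)
    have h4 := Real.log_le_sub_one_of_pos (x := r / (z : ℝ)) (by positivity)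
    rw [Real.log_div hz'.ne' hr.ne'] at h3
    rw [Real.log_div hr.ne' hz'.ne'] at h4
    have h5 := mul_le_mul_of_nonneg_left h3 hz'.le
    have h6 := mul_le_mul_of_nonneg_left h4 hz'.le
    have e1 : (z : ℝ) * (z / r - 1) = ((z : ℝ) - r) + ((z : ℝ) - r) ^ 2 / r := by
      field_simp; ring
    have e2 : (z : ℝ) * (r / z - 1) = -((z : ℝ) - r) := by field_simp; ring
    rw [e1] at h5
    rw [e2] at h6
    have h7 := le_abs_self ((z : ℝ) - r)
    have h8 := neg_abs_le ((z : ℝ) - r)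
    have h9 : 0 ≤ ((z : ℝ) - r) ^ 2 / r := by positivity
    rw [abs_le]
    constructor <;> linarith
  have h3 : harmonicEst L z - r * (Real.log r - L) =
      (harmonicEst L z - z * (Real.log z - L)) + z * (Real.log z - Real.log r) +
        ((z : ℝ) - r) * (Real.log r - L) := by ring
  rw [h3]
  calc _ ≤ |harmonicEst L z - z * (Real.log z - L)| + |z * (Real.log z - Real.log r)| +
        |((z : ℝ) - r) * (Real.log r - L)| := abs_add_three _ _ _
    _ ≤ 1 + (|(z : ℝ) - r| + ((z : ℝ) - r) ^ 2 / r) + |(z : ℝ) - r| * |Real.log r - L| := by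
        rw [abs_mul ((z : ℝ) - r)]
        gcongr
    _ = _ := by ring

lemma abs_harmonicEst_sub_target_le_of_le_one {r : ℝ} (hr : 0 ≤ r) (hr1 : r ≤ 1) {L : ℝ}
    (hL : 0 ≤ L) (z : ℕ) :
    |harmonicEst L z - r * (Real.log r - L)| ≤ (2 + L) + (z : ℝ) ^ 2 + z * L := by
  have h1 := abs_le.1 (abs_harmonicEst_sub_le L z)
  have h2 : |Real.log r * r| ≤ 1 := by
    rcases hr.eq_or_lt with rfl | hr
    · simp
    · exact (Real.abs_log_mul_self_lt r hr hr1).le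
  have h2' := abs_le.1 h2
  have h3 : 0 ≤ (z : ℝ) * Real.log z := by
    have := Real.log_natCast_nonneg z
    positivity
  have h4 : (z : ℝ) * Real.log z ≤ (z : ℝ) ^ 2 := by
    rw [sq]
    gcongr
    exact Real.log_le_self (by positivity)
  have h5 : r * L ≤ L := by nlinarith
  have h6 : 0 ≤ r * L := by positivity
  have h7 : 0 ≤ (z : ℝ) * L := by positivity
  rw [abs_le]
  constructor <;> nlinarith

/-- Mean squared error of the uncorrected estimator. -/
lemma exists_hasSum_harmonicEst_sq {r L : ℝ} (hr : 0 ≤ r) (hL : 0 ≤ L) :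
    ∃ s, HasSum (fun z => poi r z * (harmonicEst L z - r * (Real.log r - L)) ^ 2) s ∧
      s ≤ 453 * Real.exp (L / 4) + 24 * r + 4 * (r * (Real.log r - L) ^ 2) := by
  have key : ∀ (B : ℕ → ℝ) (b : ℝ), HasSum (fun z => poi r z * B z) b →
      (∀ z, (harmonicEst L z - r * (Real.log r - L)) ^ 2 ≤ B z) →
      ∃ s, HasSum (fun z => poi r z * (harmonicEst L z - r * (Real.log r - L)) ^ 2) s ∧ s ≤ b := by
    intro B b hB hle
    have hle' : ∀ z, poi r z * (harmonicEst L z - r * (Real.log r - L)) ^ 2 ≤ poi r z * B z :=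
      fun z => mul_le_mul_of_nonneg_left (hle z) (poi_nonneg hr z)
    have hs : Summable (fun z => poi r z * (harmonicEst L z - r * (Real.log r - L)) ^ 2) :=
      Summable.of_nonneg_of_le (fun z => mul_nonneg (poi_nonneg hr z) (sq_nonneg _)) hle'
        hB.summable
    exact ⟨_, hs.hasSum, hasSum_le hle' hs.hasSum hB⟩
  have hexp : 0 < Real.exp (L / 4) := Real.exp_pos _
  rcases le_or_gt 1 r with h1 | h1
  · have hr0 : 0 < r := by linarith
    set l := |Real.log r - L| with hl
    have hB := ((((hasSum_poi r).add (hasSum_poi_central_two r)).add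
      ((hasSum_poi_central_four r).mul_right (1 / r ^ 2))).add
      ((hasSum_poi_central_two r).mul_right (l ^ 2))).mul_right 4
    obtain ⟨s, hs, hle⟩ := key
      (fun z => 4 * (1 + ((z : ℝ) - r) ^ 2 + ((z : ℝ) - r) ^ 4 / r ^ 2 + ((z : ℝ) - r) ^ 2 * l ^ 2))
      _ (hB.congr_fun fun z => by ring) fun z => by
        have h := abs_harmonicEst_sub_target_le hr0 L z
        rw [← hl] at h
        have h' := pow_le_pow_left₀ (abs_nonneg _) h 2
        rw [sq_abs] at h'
        refine h'.trans ?_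
        have e1 : ((z : ℝ) - r) ^ 2 = |(z : ℝ) - r| ^ 2 := (sq_abs _).symm
        have e2 : ((z : ℝ) - r) ^ 4 / r ^ 2 = (((z : ℝ) - r) ^ 2 / r) ^ 2 := by
          rw [div_pow]; ring
        rw [e2]
        set u := ((z : ℝ) - r) ^ 2 / r
        rw [e1]
        set d := |(z : ℝ) - r|
        nlinarith [sq_nonneg (1 - d), sq_nonneg (1 - u), sq_nonneg (1 - d * l), sq_nonneg (d - u),
          sq_nonneg (d - d * l), sq_nonneg (u - d * l)]
    refine ⟨s, hs, hle.trans ?_⟩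
    have e3 : (3 * r ^ 2 + r) * (1 / r ^ 2) = 3 + 1 / r := by field_simp
    have e4 : 1 / r ≤ 1 := by rw [div_le_one hr0]; exact h1
    rw [e3, hl, sq_abs]
    nlinarith
  · have hB := (((hasSum_poi r).mul_right ((2 + L) ^ 2)).add ((hasSum_poi_pow_four r).add
      ((hasSum_poi_sq r).mul_right (L ^ 2)))).mul_right 3
    obtain ⟨s, hs, hle⟩ := key
      (fun z => 3 * ((2 + L) ^ 2 + (z : ℝ) ^ 4 + (z : ℝ) ^ 2 * L ^ 2))
      _ (hB.congr_fun fun z => by ring) fun z => by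
        have h := abs_harmonicEst_sub_target_le_of_le_one hr h1.le hL z
        have h' := pow_le_pow_left₀ (abs_nonneg _) h 2
        rw [sq_abs] at h'
        refine h'.trans ?_
        nlinarith [sq_nonneg (2 + L - (z : ℝ) ^ 2), sq_nonneg (2 + L - z * L),
          sq_nonneg ((z : ℝ) ^ 2 - z * L)]
    refine ⟨s, hs, hle.trans ?_⟩
    have h2 : L ^ 2 ≤ 32 * Real.exp (L / 4) := by
      have := Real.quadratic_le_exp_of_nonneg (x := L / 4) (by positivity)
      nlinarith
    have h3 : 1 ≤ Real.exp (L / 4) := Real.one_le_exp (by positivity)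
    have r2 : r ^ 2 ≤ 1 := by nlinarith
    have r3 : r ^ 3 ≤ 1 := pow_le_one₀ hr h1.le
    have r4 : r ^ 4 ≤ 1 := pow_le_one₀ hr h1.le
    have h4 : (r ^ 2 + r) * L ^ 2 ≤ 2 * L ^ 2 := by gcongr; linarith
    have h5 : 0 ≤ r * (Real.log r - L) ^ 2 := by positivity
    nlinarith [sq_nonneg (L - 2)]

/-- The bias-corrected coordinatewise estimator of `r log (r / n)`, with `L = log n`. -/
noncomputable def correctedEst (K : ℕ) (L : ℝ) (z : ℕ) : ℝ :=
  harmonicEst L z - z * biasCorrection K (z - 1)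

lemma exists_hasSum_correctedEst {K : ℕ} (hK : 0 < K) {r L : ℝ} (hr : 0 ≤ r) (hL : 0 ≤ L) :
    ∃ m s, HasSum (fun z => poi r z * (correctedEst K L z - r * (Real.log r - L))) m ∧
      HasSum (fun z => poi r z * (correctedEst K L z - r * (Real.log r - L)) ^ 2) s ∧
      |m| ≤ 4 / K ∧
      s ≤ 2 * 16 ^ K + 906 * Real.exp (L / 4) + 48 * r + 8 * (r * (Real.log r - L) ^ 2) := by
  obtain ⟨s₀, hs₀, hle₀⟩ := exists_hasSum_harmonicEst_sq hr hL
  have hmean : HasSum (fun z => poi r z * (correctedEst K L z - r * (Real.log r - L)))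
      (r * logBias K r) := by
    have h1 : HasSum (fun k : ℕ => poi r k * ((harmonic k : ℝ) - Real.eulerMascheroniConstant - L
        - biasCorrection K k))
        (harmonicMean r - (Real.eulerMascheroniConstant + L) - laguerreMean K r) := by
      have h := ((hasSum_harmonicMean hr).sub
        ((hasSum_poi r).mul_right (Real.eulerMascheroniConstant + L))).sub
        (hasSum_biasCorrection K r)
      rw [one_mul] at h
      exact h.congr_fun fun k => by ring
    have h2 := (hasSum_poi_shift h1).sub ((hasSum_poi r).mul_right (r * (Real.log r - L)))
    have e : r * (harmonicMean r - (Real.eulerMascheroniConstant + L) - laguerreMean K r)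
        - 1 * (r * (Real.log r - L)) = r * logBias K r := by
      rw [logBias]; ring
    rw [e] at h2
    exact h2.congr_fun fun k => by rw [correctedEst, harmonicEst]; ring
  have hle : ∀ z, poi r z * (correctedEst K L z - r * (Real.log r - L)) ^ 2 ≤
      2 * (poi r z * (harmonicEst L z - r * (Real.log r - L)) ^ 2) + poi r z * (2 * 16 ^ K) := by
    intro z
    have h := pow_le_pow_left₀ (abs_nonneg _) (abs_mul_biasCorrection_le hK z) 2
    rw [sq_abs, ← pow_mul, mul_comm K 2, pow_mul, show (4 : ℝ) ^ 2 = 16 by norm_num] at h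
    have h2 : (correctedEst K L z - r * (Real.log r - L)) ^ 2 ≤
        2 * (harmonicEst L z - r * (Real.log r - L)) ^ 2 + 2 * 16 ^ K := by
      rw [correctedEst]
      nlinarith [sq_nonneg (harmonicEst L z - r * (Real.log r - L) + z * biasCorrection K (z - 1))]
    have := mul_le_mul_of_nonneg_left h2 (poi_nonneg hr z)
    linarith
  have hb := (hs₀.mul_left 2).add ((hasSum_poi r).mul_right (2 * 16 ^ K))
  have hs : Summable (fun z => poi r z * (correctedEst K L z - r * (Real.log r - L)) ^ 2) :=
    Summable.of_nonneg_of_le (fun z => mul_nonneg (poi_nonneg hr z) (sq_nonneg _)) hle hb.summable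
  refine ⟨_, _, hmean, hs.hasSum, ?_, ?_⟩
  · rcases hr.eq_or_lt with rfl | hr
    · rw [zero_mul, abs_zero]; positivity
    · exact abs_mul_logBias_le hK hr
  · have := hasSum_le hle hs.hasSum hb
    linarith

lemma sum_mul_log_sq_le {S : ℕ} (hS : 0 < S) {P : Fin S → ℝ} (hP : P ∈ simplex S) :
    ∑ i, P i * Real.log (P i) ^ 2 ≤ 4 * Real.log S ^ 2 + 16 := by
  have hS' : (0 : ℝ) < S := by positivity
  have hterm : ∀ i, P i * Real.log (P i) ^ 2 ≤ P i * (4 * Real.log S ^ 2) + 16 / S := by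
    intro i
    have h0 := hP.1 i
    have h1 : P i ≤ 1 := by
      rw [← hP.2]
      exact Finset.single_le_sum (fun j _ => hP.1 j) (Finset.mem_univ i)
    rcases le_or_gt (1 / (S : ℝ) ^ 2) (P i) with h | h
    · have hp : 0 < P i := lt_of_lt_of_le (by positivity) h
      have h2 := Real.log_le_log (by positivity) h
      rw [Real.log_div one_ne_zero (by positivity), Real.log_one, Real.log_pow] at h2
      push_cast at h2
      have h3 := Real.log_nonpos h0 h1
      have h4 : Real.log (P i) ^ 2 ≤ 4 * Real.log S ^ 2 := by nlinarith
      have : 0 ≤ 16 / (S : ℝ) := by positivity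
      nlinarith [mul_le_mul_of_nonneg_left h4 h0]
    · have h2 : P i * Real.log (P i) ^ 2 ≤ 16 / S := by
        rcases h0.eq_or_lt with h0 | h0
        · rw [← h0, zero_mul]; positivity
        set q := Real.sqrt (Real.sqrt (P i)) with hq
        have hq0 : 0 < q := Real.sqrt_pos.2 (Real.sqrt_pos.2 h0)
        have hqs : q ^ 2 = Real.sqrt (P i) := Real.sq_sqrt (Real.sqrt_nonneg _)
        have hq4 : P i = q ^ 4 := by
          rw [show q ^ 4 = (q ^ 2) ^ 2 by ring, hqs, Real.sq_sqrt h0.le]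
        have hq1 : q ≤ 1 := by
          exact Real.sqrt_le_one.2 (Real.sqrt_le_one.2 h1)
        have hlog := Real.abs_log_mul_self_lt q hq0 hq1
        have hlog2 : (Real.log q * q) ^ 2 ≤ 1 := by
          rw [← sq_abs]
          exact pow_le_one₀ (abs_nonneg _) hlog.le
        have hqS : q ^ 2 ≤ 1 / S := by
          rw [hqs]
          refine Real.sqrt_le_iff.2 ⟨by positivity, ?_⟩
          rw [div_pow, one_pow]
          exact h.le
        rw [hq4, Real.log_pow]
        push_cast
        calc q ^ 4 * (4 * Real.log q) ^ 2 = 16 * (q ^ 2 * (Real.log q * q) ^ 2) := by ring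
          _ ≤ 16 * (1 / (S : ℝ) * 1) := by gcongr
          _ = 16 / (S : ℝ) := by ring
      have : 0 ≤ P i * (4 * Real.log S ^ 2) := by positivity
      linarith
  calc _ ≤ ∑ i, (P i * (4 * Real.log S ^ 2) + 16 / S) := Finset.sum_le_sum fun i _ => hterm i
    _ = 4 * Real.log S ^ 2 + 16 := by
      rw [Finset.sum_add_distrib, ← Finset.sum_mul, hP.2]
      simp
      field_simp

lemma poissonRisk_eq_of_hasSum {S : ℕ} {lam : ℝ} (hlam : 0 ≤ lam) {P : Fin S → ℝ}
    (hP : P ∈ simplex S) {t : ℝ} {est : (Fin S → ℕ) → ℝ} {a : ℝ}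
    (h : HasSum (fun z => poissonPMF S lam P z * (est z - t) ^ 2) a) :
    poissonRisk S lam P t est = ENNReal.ofReal a := by
  rw [poissonRisk, ← h.tsum_eq, ENNReal.ofReal_tsum_of_nonneg _ h.summable]
  intro z
  refine mul_nonneg (Finset.prod_nonneg fun i _ => ?_) (sq_nonneg _)
  exact poi_nonneg (mul_nonneg hlam (hP.1 i)) _

lemma poissonMinimax_entropy_le {S n : ℕ} (hS : 2 ≤ S) (hn : 2 ≤ n) :
    poissonMinimax S (n : ℝ) (entropy S) ≤
      ENNReal.ofReal (20000 * ((S : ℝ) ^ 2 / ((n : ℝ) * Real.log n) ^ 2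
        + (Real.log S) ^ 2 / (n : ℝ))) := by
  have hn0 : (0 : ℝ) < n := by positivity
  have hn2 : (2 : ℝ) ≤ n := by exact_mod_cast hn
  have hS2 : (2 : ℝ) ≤ S := by exact_mod_cast hS
  set L := Real.log n with hLdef
  have hL : 0 < L := Real.log_pos (by linarith)
  set K := ⌊L / 12⌋₊ + 1 with hKdef
  have hK : 0 < K := Nat.succ_pos _
  have hKge : L / 12 ≤ K := by
    rw [hKdef]; push_cast
    exact (Nat.lt_floor_add_one _).le
  have hKle : (K : ℝ) ≤ L / 12 + 1 := by
    rw [hKdef]; push_cast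
    gcongr
    exact Nat.floor_le (by positivity)
  have h16 : (16 : ℝ) ^ K ≤ 16 * Real.exp (L / 4) := by
    have hlog16 : Real.log 16 ≤ 3 := by
      rw [show (16 : ℝ) = 2 ^ 4 by norm_num, Real.log_pow]
      have := Real.log_two_lt_d9
      norm_num
      linarith
    calc (16 : ℝ) ^ K = Real.exp (Real.log 16 * K) := by
          rw [mul_comm, Real.exp_nat_mul, Real.exp_log (by norm_num)]
      _ ≤ Real.exp (Real.log 16 + L / 4) := by
          gcongr
          have : 0 ≤ Real.log 16 := Real.log_nonneg (by norm_num)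
          nlinarith
      _ = 16 * Real.exp (L / 4) := by rw [Real.exp_add, Real.exp_log (by norm_num)]
  have hlog2 : 0.69 ≤ Real.log S := by
    have := Real.log_le_log (by norm_num) hS2
    have := Real.log_two_gt_d9
    linarith
  have hlogsq : 0.47 ≤ Real.log S ^ 2 := by nlinarith
  set est : (Fin S → ℕ) → ℝ := fun z => -(∑ i, correctedEst K L (z i)) / n with hest
  refine iInf_le_of_le est (iSup₂_le fun P hP => ?_)
  choose m s hm hs hmle hsle using fun i : Fin S =>
    exists_hasSum_correctedEst hK (mul_nonneg hn0.le (hP.1 i)) hL.le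
  have htarget : ∀ i, (n * P i) * (Real.log (n * P i) - L) = n * (P i * Real.log (P i)) := by
    intro i
    rcases (hP.1 i).eq_or_lt with h | h
    · rw [← h]; simp
    · rw [Real.log_mul hn0.ne' h.ne']; ring
  have htarget2 : ∀ i, (n * P i) * (Real.log (n * P i) - L) ^ 2 =
      n * (P i * Real.log (P i) ^ 2) := by
    intro i
    rcases (hP.1 i).eq_or_lt with h | h
    · rw [← h]; simp
    · rw [Real.log_mul hn0.ne' h.ne']; ring
  have hmom := (hasSum_pi_moments (fun i => hasSum_poi (n * P i)) hm hs).2.mul_right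
    (1 / (n : ℝ) ^ 2)
  have hrisk : HasSum (fun z => poissonPMF S n P z * (est z - entropy S P) ^ 2)
      ((∑ i, (s i - m i ^ 2) + (∑ i, m i) ^ 2) * (1 / (n : ℝ) ^ 2)) := by
    refine hmom.congr_fun fun z => ?_
    have e : est z - entropy S P = -(∑ i, (correctedEst K L (z i)
        - (n * P i) * (Real.log (n * P i) - L))) / n := by
      simp only [hest, entropy, htarget, Finset.sum_sub_distrib, Finset.sum_neg_distrib,
        ← Finset.mul_sum]
      field_simp
      ring
    rw [e, poissonPMF_eq_prod_poi]
    ring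
  rw [poissonRisk_eq_of_hasSum hn0.le hP hrisk]
  apply ENNReal.ofReal_le_ofReal
  set A := Real.exp (L / 4) with hA
  have hsum_s : ∑ i, (s i - m i ^ 2) ≤ 1000 * (S * A) + n * (80 * Real.log S ^ 2 + 176) := by
    calc ∑ i, (s i - m i ^ 2) ≤
          ∑ i, (1000 * A + 48 * (n * P i) + 8 * (n * (P i * Real.log (P i) ^ 2))) := by
          refine Finset.sum_le_sum fun i _ => ?_
          have h1 := hsle i
          rw [htarget2] at h1
          have h2 : 0 < A := Real.exp_pos _
          nlinarith [sq_nonneg (m i)]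
      _ = 1000 * (S * A) + 48 * n + 8 * (n * ∑ i, P i * Real.log (P i) ^ 2) := by
          simp only [Finset.sum_add_distrib, ← Finset.mul_sum, hP.2]
          simp
      _ ≤ 1000 * (S * A) + 48 * n + 8 * (n * (4 * Real.log S ^ 2 + 16)) := by
          gcongr
          exact sum_mul_log_sq_le (by omega) hP
      _ ≤ _ := by nlinarith [sq_nonneg (Real.log S)]
  have hsum_m : (∑ i, m i) ^ 2 ≤ 2304 * (S ^ 2 / L ^ 2) := by
    have h1 : |∑ i, m i| ≤ 48 * S / L := by
      calc |∑ i, m i| ≤ ∑ i, |m i| := Finset.abs_sum_le_sum_abs _ _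
        _ ≤ ∑ _i : Fin S, 4 / (K : ℝ) := Finset.sum_le_sum fun i _ => hmle i
        _ = S * (4 / K) := by simp
        _ ≤ S * (4 / (L / 12)) := by gcongr
        _ = 48 * S / L := by field_simp; ring
    have h2 := pow_le_pow_left₀ (abs_nonneg _) h1 2
    rw [sq_abs] at h2
    calc _ ≤ _ := h2
      _ = _ := by field_simp; ring
  have hSA : S * A ≤ 8 * (S ^ 2 / L ^ 2) + n := by
    have h1 : L ^ 2 ≤ 8 * A ^ 2 := by
      have := Real.quadratic_le_exp_of_nonneg (x := L / 2) (by positivity)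
      have e : A ^ 2 = Real.exp (L / 2) := by rw [hA, ← Real.exp_nat_mul]; ring_nf
      rw [e]
      nlinarith
    have h2 : A ^ 4 = n := by
      rw [hA, ← Real.exp_nat_mul, ← Real.exp_log hn0]; congr 1; push_cast; ring
    have h3 : (S / A) ^ 2 ≤ 8 * (S ^ 2 / L ^ 2) := by
      have hA0 : 0 < A := Real.exp_pos _
      rw [div_pow, ← mul_div_assoc, div_le_div_iff₀ (by positivity) (by positivity)]
      nlinarith [mul_le_mul_of_nonneg_left h1 (sq_nonneg (S : ℝ))]
    have hA0 : 0 < A := Real.exp_pos _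
    have h4 : S * A = (S / A) * A ^ 2 := by field_simp
    have hSA0 : 0 ≤ (S / A) * A ^ 2 := by positivity
    rw [h4]
    nlinarith [sq_nonneg (S / A - A ^ 2)]
  have hfin : ∑ i, (s i - m i ^ 2) + (∑ i, m i) ^ 2 ≤
      20000 * (S ^ 2 / L ^ 2) + n * (20000 * Real.log S ^ 2) := by
    have h0 : 0 ≤ (S : ℝ) ^ 2 / L ^ 2 := by positivity
    have h1 : (n : ℝ) * 1176 ≤ n * (3000 * Real.log S ^ 2) := by gcongr; linarith
    have h2 : 0 ≤ (n : ℝ) * Real.log S ^ 2 := by positivity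
    linarith
  calc _ ≤ (20000 * (S ^ 2 / L ^ 2) + n * (20000 * Real.log S ^ 2)) * (1 / (n : ℝ) ^ 2) := by
        gcongr
    _ = _ := by field_simp

/-- The `ℓ¹` distance between `p` and `q` is at most `t`. -/
def L1Close {α : Type*} (p q : α → ℝ) (t : ℝ) : Prop :=
  Summable (fun z => |p z - q z|) ∧ ∑' z, |p z - q z| ≤ t

lemma L1Close.of_le {α : Type*} {p q B : α → ℝ} {b t : ℝ} (hB : HasSum B b)
    (hle : ∀ z, |p z - q z| ≤ B z) (hb : b ≤ t) : L1Close p q t := by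
  have hs : Summable (fun z => |p z - q z|) :=
    Summable.of_nonneg_of_le (fun z => abs_nonneg _) hle hB.summable
  exact ⟨hs, (hasSum_le hle hs.hasSum hB).trans hb⟩

lemma L1Close.refl {α : Type*} (p : α → ℝ) : L1Close p p 0 := by
  simp [L1Close]

lemma L1Close.prod {S : ℕ} {p q : Fin S → ℕ → ℝ} {t : Fin S → ℝ}
    (hp0 : ∀ i k, 0 ≤ p i k) (hq0 : ∀ i k, 0 ≤ q i k)
    (hp : ∀ i, HasSum (p i) 1) (hq : ∀ i, HasSum (q i) 1)
    (h : ∀ i, L1Close (p i) (q i) (t i)) :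
    L1Close (fun z : Fin S → ℕ => ∏ i, p i (z i)) (fun z => ∏ i, q i (z i)) (∑ i, t i) := by
  induction S with
  | zero => simp [L1Close]
  | succ S ih =>
    have h1 := ih (p := fun i => p i.succ) (q := fun i => q i.succ) (t := fun i => t i.succ)
      (fun i => hp0 i.succ) (fun i => hq0 i.succ) (fun i => hp i.succ) (fun i => hq i.succ)
      (fun i => h i.succ)
    have hP : HasSum (fun z : Fin S → ℕ => ∏ i, p i.succ (z i)) 1 := by
      simpa using hasSum_pi_prod (f := fun i => p i.succ) fun i => hp i.succ
    have hB := ((h 0).1.hasSum.mul_pair hP).add ((hq 0).mul_pair h1.1.hasSum)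
    have hB' := ((Fin.consEquiv (fun _ : Fin (S + 1) => ℕ)).symm.hasSum_iff).2 hB
    refine L1Close.of_le hB' (fun z => ?_) ?_
    · have hP0 : 0 ≤ ∏ i : Fin S, p i.succ (z i.succ) := Finset.prod_nonneg fun i _ => hp0 _ _
      simp only [Fin.prod_univ_succ, Function.comp_apply, Fin.consEquiv, Equiv.coe_fn_symm_mk,
        Fin.tail]
      set u := ∏ i : Fin S, p i.succ (z i.succ)
      set v := ∏ i : Fin S, q i.succ (z i.succ)
      have e : p 0 (z 0) * u - q 0 (z 0) * v =
          (p 0 (z 0) - q 0 (z 0)) * u + q 0 (z 0) * (u - v) := by ring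
      rw [e]
      refine (abs_add_le _ _).trans (le_of_eq ?_)
      rw [abs_mul, abs_mul, abs_of_nonneg hP0, abs_of_nonneg (hq0 0 _)]
    · rw [Fin.sum_univ_succ, mul_one, one_mul]
      exact add_le_add (h 0).2 h1.2

/-- Total variation between Poisson products is controlled by the Hellinger distance. -/
lemma l1Close_prod_poi {S : ℕ} {a b : Fin S → ℝ} (ha : ∀ i, 0 ≤ a i) (hb : ∀ i, 0 ≤ b i)
    {ε : ℝ} (hε : 0 < ε) :
    L1Close (fun z : Fin S → ℕ => ∏ i, poi (a i) (z i)) (fun z => ∏ i, poi (b i) (z i))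
      ((∑ i, (√(a i) - √(b i)) ^ 2) / (2 * ε) + 2 * ε) := by
  set D := ∑ i, (√(a i) - √(b i)) ^ 2 with hD
  set r : Fin S → ℕ → ℝ := fun i k =>
    Real.exp (-((a i + b i) / 2)) * ((√(a i) * √(b i)) ^ k / (Nat.factorial k : ℝ)) with hr
  have hr0 : ∀ i k, 0 ≤ r i k := fun i k => by simp only [hr]; positivity
  have hrr : ∀ i k, r i k ^ 2 = poi (a i) k * poi (b i) k := fun i k => by
    simp only [hr, poi]
    rw [mul_pow, ← Real.exp_nat_mul, div_pow, ← pow_mul, mul_comm k 2, pow_mul, mul_pow,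
      Real.sq_sqrt (ha i), Real.sq_sqrt (hb i), mul_pow]
    have : Real.exp (((2 : ℕ) : ℝ) * -((a i + b i) / 2)) = Real.exp (-a i) * Real.exp (-b i) := by
      rw [← Real.exp_add]; congr 1; push_cast; ring
    rw [this]
    field_simp
  have hrs : ∀ i, HasSum (r i) (Real.exp (-((√(a i) - √(b i)) ^ 2 / 2))) := fun i => by
    have h := (hasSum_pow_div_factorial (√(a i) * √(b i))).mul_left
      (Real.exp (-((a i + b i) / 2)))
    rw [← Real.exp_add] at h
    have e : -((√(a i) - √(b i)) ^ 2 / 2) = -((a i + b i) / 2) + √(a i) * √(b i) := by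
      linear_combination -(1 / 2) * Real.sq_sqrt (ha i) - (1 / 2) * Real.sq_sqrt (hb i)
    rw [e]
    exact h
  have hR := hasSum_pi_prod hrs
  rw [← Real.exp_sum, Finset.sum_neg_distrib, ← Finset.sum_div, ← hD] at hR
  have hA := hasSum_pi_prod fun i => hasSum_poi (a i)
  have hB := hasSum_pi_prod fun i => hasSum_poi (b i)
  rw [Finset.prod_const_one] at hA hB
  have hM := (((hA.add hB).sub (hR.mul_left 2)).mul_left (1 / (2 * ε))).add
    (((hA.add hB).add (hR.mul_left 2)).mul_left (ε / 2))
  refine L1Close.of_le hM (fun z => ?_) ?_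
  · set p := ∏ i, poi (a i) (z i) with hp
    set q := ∏ i, poi (b i) (z i) with hq
    have hp0 : 0 ≤ p := Finset.prod_nonneg fun i _ => poi_nonneg (ha i) _
    have hq0 : 0 ≤ q := Finset.prod_nonneg fun i _ => poi_nonneg (hb i) _
    have hrpq : ∏ i, r i (z i) = √p * √q := by
      rw [← Real.sqrt_mul hp0, hp, hq, ← Finset.prod_mul_distrib,
        ← Finset.prod_congr rfl fun i _ => hrr i (z i), Finset.prod_pow,
        Real.sqrt_sq (Finset.prod_nonneg fun i _ => hr0 i _)]
    rw [hrpq]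
    have e1 := Real.sq_sqrt hp0
    have e2 := Real.sq_sqrt hq0
    set u := √p
    set v := √q
    have e3 : p - q = (u - v) * (u + v) := by rw [← e1, ← e2]; ring
    have e4 : 1 / (2 * ε) * (p + q - 2 * (u * v)) + ε / 2 * (p + q + 2 * (u * v)) =
        1 / (2 * ε) * ((u - v) ^ 2 + (ε * (u + v)) ^ 2) := by
      rw [← e1, ← e2]; field_simp; ring
    rw [e3, e4, abs_le]
    have h2ε : 0 < 1 / (2 * ε) := by positivity
    have e5 : (u - v) * (u + v) = 1 / (2 * ε) * (2 * ((u - v) * (ε * (u + v)))) := by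
      field_simp
    rw [e5, ← mul_neg]
    constructor
    · exact mul_le_mul_of_nonneg_left (by nlinarith [sq_nonneg (u - v + ε * (u + v))]) h2ε.le
    · exact mul_le_mul_of_nonneg_left (by nlinarith [sq_nonneg (u - v - ε * (u + v))]) h2ε.le
  · have h1 := Real.add_one_le_exp (-(D / 2))
    have h2 : Real.exp (-(D / 2)) ≤ 1 := by
      rw [Real.exp_le_one_iff]
      have : 0 ≤ D := Finset.sum_nonneg fun i _ => sq_nonneg _
      linarith
    have h3 : 1 / (2 * ε) * (1 + 1 - 2 * Real.exp (-(D / 2))) ≤ 1 / (2 * ε) * D := by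
      gcongr; linarith
    have h4 : ε / 2 * (1 + 1 + 2 * Real.exp (-(D / 2))) ≤ ε / 2 * 4 := by gcongr; linarith
    calc _ ≤ 1 / (2 * ε) * D + ε / 2 * 4 := add_le_add h3 h4
      _ = _ := by ring

lemma le_poissonMinimax {S : ℕ} {lam : ℝ} {F : (Fin S → ℝ) → ℝ} {c : ℝ}
    (h : ∀ (est : (Fin S → ℕ) → ℝ) (R : ℝ), 0 ≤ R →
      (∀ P ∈ simplex S, poissonRisk S lam P (F P) est ≤ ENNReal.ofReal R) → c ≤ R) :
    ENNReal.ofReal c ≤ poissonMinimax S lam F := by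
  refine le_iInf fun est => ?_
  by_cases htop : (⨆ P ∈ simplex S, poissonRisk S lam P (F P) est) = ⊤
  · rw [htop]; exact le_top
  · rw [← ENNReal.ofReal_toReal htop]
    refine ENNReal.ofReal_le_ofReal (h est _ ENNReal.toReal_nonneg fun P hP => ?_)
    rw [ENNReal.ofReal_toReal htop]
    exact le_iSup₂ (f := fun P (_ : P ∈ simplex S) => poissonRisk S lam P (F P) est) P hP

/-- A test statistic rejecting the value `h` at separation `g`. -/
noncomputable def separationTest {α : Type*} (est : α → ℝ) (g h : ℝ) (z : α) : ℝ :=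
  min 1 (4 / g ^ 2 * (est z - h) ^ 2)

lemma separationTest_nonneg {α : Type*} (est : α → ℝ) (g h : ℝ) (z : α) :
    0 ≤ separationTest est g h z :=
  le_min zero_le_one (by positivity)

lemma separationTest_le_one {α : Type*} (est : α → ℝ) (g h : ℝ) (z : α) :
    separationTest est g h z ≤ 1 := min_le_left _ _

lemma one_le_separationTest_add {α : Type*} (est : α → ℝ) {g h₀ h₁ : ℝ} (hg : 0 < g)
    (hh : g ≤ |h₀ - h₁|) (z : α) :
    1 ≤ separationTest est g h₀ z + separationTest est g h₁ z := by
  have key : ∀ h, g / 2 ≤ |est z - h| → 1 ≤ separationTest est g h z := fun h hle => by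
    refine le_min le_rfl ?_
    have := pow_le_pow_left₀ (by positivity) hle 2
    rw [sq_abs] at this
    calc (1 : ℝ) = 4 / g ^ 2 * (g / 2) ^ 2 := by field_simp; norm_num
      _ ≤ _ := by gcongr
  rcases le_or_gt (g / 2) |est z - h₀| with h | h
  · linarith [key h₀ h, separationTest_nonneg est g h₁ z]
  · have : g / 2 ≤ |est z - h₁| := by
      have h2 := abs_sub_le h₀ (est z) h₁
      rw [abs_sub_comm h₀ (est z)] at h2
      linarith
    linarith [key h₁ this, separationTest_nonneg est g h₀ z]

lemma Summable.mul_separationTest {α : Type*} {p : α → ℝ} (hp0 : ∀ z, 0 ≤ p z) (hp : Summable p)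
    (est : α → ℝ) (g h : ℝ) : Summable fun z => p z * separationTest est g h z :=
  Summable.of_nonneg_of_le (fun z => mul_nonneg (hp0 z) (separationTest_nonneg _ _ _ _))
    (fun z => mul_le_of_le_one_right (hp0 z) (separationTest_le_one _ _ _ _)) hp

lemma poissonPMF_nonneg {S : ℕ} {lam : ℝ} (hlam : 0 ≤ lam) {P : Fin S → ℝ} (hP : P ∈ simplex S)
    (z : Fin S → ℕ) : 0 ≤ poissonPMF S lam P z :=
  Finset.prod_nonneg fun i _ => poi_nonneg (mul_nonneg hlam (hP.1 i)) _

lemma hasSum_poissonPMF (S : ℕ) (lam : ℝ) (P : Fin S → ℝ) : HasSum (poissonPMF S lam P) 1 := by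
  have := hasSum_pi_prod fun i => hasSum_poi (lam * P i)
  rwa [Finset.prod_const_one] at this

lemma tsum_mul_separationTest_le {S : ℕ} {lam : ℝ} (hlam : 0 ≤ lam) {P : Fin S → ℝ}
    (hP : P ∈ simplex S) {t R : ℝ} (hR : 0 ≤ R) {est : (Fin S → ℕ) → ℝ}
    (hrisk : poissonRisk S lam P t est ≤ ENNReal.ofReal R) {g h x : ℝ} (hg : 0 < g)
    (hx : min 1 (8 / g ^ 2 * (t - h) ^ 2) ≤ x) :
    ∑' z, poissonPMF S lam P z * separationTest est g h z ≤ 8 * R / g ^ 2 + x := by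
  have hp0 := poissonPMF_nonneg hlam hP
  have hp := hasSum_poissonPMF S lam P
  have hs := Summable.mul_separationTest hp0 hp.summable est g h
  have hR' : 0 ≤ 8 * R / g ^ 2 := by positivity
  have hq0 : ∀ z, 0 ≤ poissonPMF S lam P z * (est z - t) ^ 2 :=
    fun z => mul_nonneg (hp0 z) (sq_nonneg _)
  have hsum : Summable fun z => poissonPMF S lam P z * (est z - t) ^ 2 := by
    refine (summable_congr fun z => ?_).1
      (ENNReal.summable_toReal (ne_top_of_le_ne_top ENNReal.ofReal_ne_top hrisk))
    exact ENNReal.toReal_ofReal (hq0 z)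
  have hle : ∑' z, poissonPMF S lam P z * (est z - t) ^ 2 ≤ R := by
    rw [poissonRisk, ← ENNReal.ofReal_tsum_of_nonneg hq0 hsum] at hrisk
    exact (ENNReal.ofReal_le_ofReal_iff hR).1 hrisk
  rcases min_le_iff.1 hx with h1 | h1
  · have h2 : ∑' z, poissonPMF S lam P z * separationTest est g h z ≤ 1 :=
      hasSum_le (fun z => mul_le_of_le_one_right (hp0 z) (separationTest_le_one _ _ _ _))
        hs.hasSum hp
    linarith
  · have hb := (hsum.hasSum.mul_left (8 / g ^ 2)).add (hp.mul_right (8 / g ^ 2 * (t - h) ^ 2))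
    have h2 : ∑' z, poissonPMF S lam P z * separationTest est g h z ≤ _ :=
      hasSum_le (fun z => ?_) hs.hasSum hb
    · have h3 : 8 / g ^ 2 * ∑' z, poissonPMF S lam P z * (est z - t) ^ 2 ≤ 8 / g ^ 2 * R := by
        gcongr
      have e : 8 / g ^ 2 * R = 8 * R / g ^ 2 := by ring
      linarith
    · have h4 : separationTest est g h z ≤
          8 / g ^ 2 * (est z - t) ^ 2 + 8 / g ^ 2 * (t - h) ^ 2 := by
        refine (min_le_right _ _).trans ?_
        have h5 : (est z - h) ^ 2 ≤ 2 * (est z - t) ^ 2 + 2 * (t - h) ^ 2 := by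
          nlinarith [sq_nonneg ((est z - t) - (t - h))]
        calc _ ≤ 4 / g ^ 2 * (2 * (est z - t) ^ 2 + 2 * (t - h) ^ 2) := by gcongr
          _ = _ := by ring
      have := mul_le_mul_of_nonneg_left h4 (hp0 z)
      linarith

lemma L1Close.tsum_mul_le {α : Type*} {p q : α → ℝ} {t : ℝ} (h : L1Close p q t)
    (hp0 : ∀ z, 0 ≤ p z) (hq0 : ∀ z, 0 ≤ q z) (hp : Summable p) (hq : Summable q)
    (est : α → ℝ) (g a : ℝ) :
    ∑' z, q z * separationTest est g a z ≤ ∑' z, p z * separationTest est g a z + t := by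
  have h1 := (Summable.mul_separationTest hp0 hp est g a).hasSum.add h.1.hasSum
  have h2 := (Summable.mul_separationTest hq0 hq est g a).hasSum
  have h3 := hasSum_le (fun z => ?_) h2 h1
  · linarith [h.2]
  · have h4 := separationTest_nonneg est g a z
    have h5 := separationTest_le_one est g a z
    have h6 := neg_abs_le (p z - q z)
    have h7 := abs_nonneg (p z - q z)
    nlinarith

/-- Lower bound for the average success of a test under a mixture of near-Poisson laws. -/
lemma tsum_mixture_mul_separationTest_le {S : ℕ} {lam : ℝ} (hlam : 0 ≤ lam)
    {F : (Fin S → ℝ) → ℝ} {R : ℝ} (hR : 0 ≤ R) {est : (Fin S → ℕ) → ℝ}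
    (hrisk : ∀ P ∈ simplex S, poissonRisk S lam P (F P) est ≤ ENNReal.ofReal R)
    {g h : ℝ} (hg : 0 < g) {ι : Type*} [Fintype ι] {W x t : ι → ℝ} (hW0 : ∀ J, 0 ≤ W J)
    (hW : ∑ J, W J = 1) {P : ι → Fin S → ℝ} (hP : ∀ J, P J ∈ simplex S)
    {q : ι → (Fin S → ℕ) → ℝ} (hq0 : ∀ J z, 0 ≤ q J z) (hq : ∀ J, Summable (q J))
    (hclose : ∀ J, L1Close (poissonPMF S lam (P J)) (q J) (t J))
    (hx : ∀ J, min 1 (8 / g ^ 2 * (F (P J) - h) ^ 2) ≤ x J) :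
    ∑' z, (∑ J, W J * q J z) * separationTest est g h z ≤
      8 * R / g ^ 2 + ∑ J, W J * (x J + t J) := by
  have hs := fun J => Summable.mul_separationTest (hq0 J) (hq J) est g h
  have hb : HasSum (fun z => (∑ J, W J * q J z) * separationTest est g h z)
      (∑ J, W J * ∑' z, q J z * separationTest est g h z) := by
    refine (hasSum_sum fun J _ => (hs J).hasSum.mul_left (W J)).congr_fun fun z => ?_
    rw [Finset.sum_mul]
    exact Finset.sum_congr rfl fun J _ => mul_assoc _ _ _
  rw [hb.tsum_eq]
  calc _ ≤ ∑ J, W J * (8 * R / g ^ 2 + (x J + t J)) := by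
        refine Finset.sum_le_sum fun J _ => mul_le_mul_of_nonneg_left ?_ (hW0 J)
        have h1 := (hclose J).tsum_mul_le (poissonPMF_nonneg hlam (hP J)) (hq0 J)
          (hasSum_poissonPMF S lam (P J)).summable (hq J) est g h
        have h2 := tsum_mul_separationTest_le hlam (hP J) hR (hrisk _ (hP J)) hg (hx J)
        linarith
    _ = _ := by
        simp only [mul_add, Finset.sum_add_distrib, ← Finset.sum_mul, hW, one_mul]

lemma one_le_of_separationTest {α : Type*} {q₀ q₁ : α → ℝ} {τ : ℝ} (h : L1Close q₁ q₀ τ)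
    (hq₀ : ∀ z, 0 ≤ q₀ z) (hq₁ : ∀ z, 0 ≤ q₁ z) (hs₀ : HasSum q₀ 1) (hs₁ : Summable q₁)
    (est : α → ℝ) {g h₀ h₁ : ℝ} (hg : 0 < g) (hh : g ≤ |h₀ - h₁|) :
    1 ≤ ∑' z, q₀ z * separationTest est g h₀ z + ∑' z, q₁ z * separationTest est g h₁ z + τ := by
  have h1 := h.tsum_mul_le hq₁ hq₀ hs₁ hs₀.summable est g h₁
  have h2 := (Summable.mul_separationTest hq₀ hs₀.summable est g h₀).hasSum.add
    (Summable.mul_separationTest hq₀ hs₀.summable est g h₁).hasSum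
  have h3 := hasSum_le (fun z => ?_) hs₀ h2
  · linarith
  · have := mul_le_mul_of_nonneg_left (one_le_separationTest_add est hg hh z) (hq₀ z)
    linarith

lemma sq_sqrt_sub_sqrt_le {a b : ℝ} (ha : 0 ≤ a) (hb : 0 < b) :
    (√a - √b) ^ 2 ≤ (a - b) ^ 2 / b := by
  rw [le_div_iff₀ hb]
  have h1 := Real.sq_sqrt ha
  have h2 := Real.sq_sqrt hb.le
  have h3 := Real.sqrt_nonneg a
  have h4 := Real.sqrt_nonneg b
  set u := √a
  set v := √b
  rw [← h1, ← h2]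
  have e : (u ^ 2 - v ^ 2) ^ 2 = (u - v) ^ 2 * (u + v) ^ 2 := by ring
  rw [e]
  gcongr
  linarith

lemma le_risk_two_point {S n : ℕ} (hS : 2 ≤ S) (hn : 2 ≤ n) {est : (Fin S → ℕ) → ℝ} {R : ℝ}
    (hR : 0 ≤ R)
    (hrisk : ∀ P ∈ simplex S, poissonRisk S n P (entropy S P) est ≤ ENNReal.ofReal R) :
    1 / 4000 * (Real.log S ^ 2 / n) ≤ R := by
  obtain ⟨T, rfl⟩ : ∃ T, S = T + 1 := ⟨S - 1, by omega⟩
  have hT : (1 : ℝ) ≤ T := by exact_mod_cast (by omega : 1 ≤ T)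
  have hT0 : (0 : ℝ) < T := by linarith
  have hn0 : (0 : ℝ) < n := by positivity
  have hn1 : (1 : ℝ) ≤ n := by exact_mod_cast (by omega : 1 ≤ n)
  set δ : ℝ := 1 / (12 * √n) with hδ
  have hsn : 1 ≤ √(n : ℝ) := Real.one_le_sqrt.2 hn1
  have hδ0 : 0 < δ := by positivity
  have hδ1 : δ ≤ 1 / 12 := by
    rw [hδ]
    gcongr
    linarith
  have hδn : n * δ ^ 2 = 1 / 144 := by
    rw [hδ, div_pow, mul_pow, Real.sq_sqrt hn0.le]
    field_simp
    norm_num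
  set P : ℝ → Fin (T + 1) → ℝ := fun p => Fin.cons p fun _ => (1 - p) / T with hPdef
  have hP : ∀ p, 0 ≤ p → p ≤ 1 → P p ∈ simplex (T + 1) := by
    intro p h0 h1
    refine ⟨fun i => ?_, ?_⟩
    · refine Fin.cases ?_ (fun j => ?_) i
      · simpa [hPdef] using h0
      · simp only [hPdef, Fin.cons_succ]
        have : 0 ≤ 1 - p := by linarith
        positivity
    · simp [hPdef, Fin.sum_univ_succ]
      field_simp
      ring
  have hent : ∀ p, entropy (T + 1) (P p) =
      -(p * Real.log p) - (1 - p) * Real.log ((1 - p) / T) := by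
    intro p
    simp [entropy, hPdef, Fin.sum_univ_succ]
    field_simp
    ring
  set p₁ : ℝ := 2 / 3 + δ with hp₁
  have hgap : δ * Real.log ((T + 1 : ℕ) : ℝ) ≤
      entropy (T + 1) (P (2 / 3)) - entropy (T + 1) (P p₁) := by
    rw [hent, hent]
    have hq : 0 < 1 - p₁ := by linarith
    have hp : 0 < p₁ := by linarith
    have h1 := Real.log_le_sub_one_of_pos (x := (2 / 3) / p₁) (by positivity)
    rw [Real.log_div (by norm_num) hp.ne'] at h1
    have h2 := Real.log_le_sub_one_of_pos (x := (1 / 3) / (1 - p₁)) (by positivity)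
    rw [Real.log_div (by norm_num) hq.ne'] at h2
    have h3 := mul_le_mul_of_nonneg_left h1 hp.le
    have h4 := mul_le_mul_of_nonneg_left h2 hq.le
    have e3 : p₁ * (2 / 3 / p₁ - 1) = 2 / 3 - p₁ := by field_simp
    have e4 : (1 - p₁) * (1 / 3 / (1 - p₁) - 1) = 1 / 3 - (1 - p₁) := by field_simp
    rw [e3] at h3
    rw [e4] at h4
    have e5 : (1 - 2 / 3 : ℝ) = 1 / 3 := by norm_num
    rw [e5, Real.log_div hq.ne' hT0.ne', Real.log_div (by norm_num) hT0.ne']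
    have h5 : Real.log ((T + 1 : ℕ) : ℝ) ≤ Real.log (2 / 3) - Real.log (1 / 3) + Real.log T := by
      rw [← Real.log_div (by norm_num) (by norm_num), ← Real.log_mul (by norm_num) hT0.ne']
      refine Real.log_le_log (by positivity) ?_
      push_cast
      linarith
    have h6 := mul_le_mul_of_nonneg_left h5 hδ0.le
    have e6 : p₁ * (Real.log (2 / 3) - Real.log p₁) = (2 / 3) * Real.log (2 / 3)
        + δ * Real.log (2 / 3) - p₁ * Real.log p₁ := by rw [hp₁]; ring
    have e7 : (1 - p₁) * (Real.log (1 / 3) - Real.log (1 - p₁)) = (1 / 3) * Real.log (1 / 3)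
        - δ * Real.log (1 / 3) - (1 - p₁) * Real.log (1 - p₁) := by rw [hp₁]; ring
    have e8 : (1 - p₁) * (Real.log (1 - p₁) - Real.log T) = (1 - p₁) * Real.log (1 - p₁)
        - (1 / 3) * Real.log T + δ * Real.log T := by rw [hp₁]; ring
    rw [e6] at h3
    rw [e7] at h4
    rw [e8]
    linarith
  have hP0 := hP (2 / 3) (by norm_num) (by norm_num)
  have hP1 := hP p₁ (by linarith) (by linarith)
  set g := δ * Real.log ((T + 1 : ℕ) : ℝ) with hg
  have hlog : 0 < Real.log ((T + 1 : ℕ) : ℝ) := Real.log_pos (by push_cast; linarith)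
  have hg0 : 0 < g := by positivity
  have hclose : L1Close (poissonPMF (T + 1) n (P p₁))
      (poissonPMF (T + 1) n (P (2 / 3))) (3 / 8) := by
    have h := l1Close_prod_poi (a := fun i => n * P p₁ i) (b := fun i => n * P (2 / 3) i)
      (fun i => mul_nonneg hn0.le (hP1.1 i)) (fun i => mul_nonneg hn0.le (hP0.1 i))
      (ε := 1 / 8) (by norm_num)
    refine ⟨h.1, h.2.trans ?_⟩
    have hD : ∑ i, (√(n * P p₁ i) - √(n * P (2 / 3) i)) ^ 2 ≤ 1 / 32 := by
      rw [Fin.sum_univ_succ]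
      have h1 : (√(n * P p₁ 0) - √(n * P (2 / 3) 0)) ^ 2 ≤ 3 / 2 * (n * δ ^ 2) := by
        refine (sq_sqrt_sub_sqrt_le (mul_nonneg hn0.le (hP1.1 0)) ?_).trans (le_of_eq ?_)
        · simp [hPdef]; positivity
        · simp [hPdef, hp₁]
          field_simp
          ring
      have h2 : ∀ i : Fin T, (√(n * P p₁ i.succ) - √(n * P (2 / 3) i.succ)) ^ 2 ≤
          3 * (n * δ ^ 2) / T := by
        intro i
        have e1 : P (2 / 3) i.succ = 1 / 3 / T := by
          simp only [hPdef, Fin.cons_succ]; norm_num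
        have e2 : P p₁ i.succ = (1 / 3 - δ) / T := by
          simp only [hPdef, Fin.cons_succ, hp₁]; ring
        refine (sq_sqrt_sub_sqrt_le (mul_nonneg hn0.le (hP1.1 _)) ?_).trans (le_of_eq ?_)
        · rw [e1]; positivity
        · rw [e1, e2]
          field_simp
          ring
      have h3 := Finset.sum_le_sum fun (i : Fin T) (_ : i ∈ Finset.univ) => h2 i
      rw [Finset.sum_const, Finset.card_univ, Fintype.card_fin, nsmul_eq_mul,
        mul_div_cancel₀ _ hT0.ne'] at h3
      rw [hδn] at h1 h3
      linarith
    calc _ ≤ (1 / 32 : ℝ) / (2 * (1 / 8)) + 2 * (1 / 8) := by gcongr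
      _ = 3 / 8 := by norm_num
  have h0 := tsum_mul_separationTest_le hn0.le hP0 hR (hrisk _ hP0)
    (h := entropy (T + 1) (P (2 / 3))) (x := 0) hg0 (by simp)
  have h1 := tsum_mul_separationTest_le hn0.le hP1 hR (hrisk _ hP1)
    (h := entropy (T + 1) (P p₁)) (x := 0) hg0 (by simp)
  have h2 := one_le_of_separationTest hclose (poissonPMF_nonneg hn0.le hP0)
    (poissonPMF_nonneg hn0.le hP1) (hasSum_poissonPMF _ _ _) (hasSum_poissonPMF _ _ _).summable
    est hg0 (hgap.trans (le_abs_self _))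
  have h3 : 5 / 8 ≤ 16 * R / g ^ 2 := by
    have : 8 * R / g ^ 2 + 8 * R / g ^ 2 = 16 * R / g ^ 2 := by ring
    linarith
  rw [le_div_iff₀ (by positivity)] at h3
  have e : g ^ 2 = (1 / 144) * (Real.log ((T + 1 : ℕ) : ℝ) ^ 2 / n) := by
    rw [hg, mul_pow, ← hδn]
    field_simp
  rw [e] at h3
  have : 0 ≤ Real.log ((T + 1 : ℕ) : ℝ) ^ 2 / n := by positivity
  linarith

/-- Weights annihilating low-degree polynomials on the nodes `v 0, …, v m`, normalized to equal
`1` at the node `v 0 = 0`. -/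
noncomputable def dualWeight (v : ℕ → ℝ) (m j : ℕ) : ℝ :=
  (∏ i ∈ Finset.range m, -v (i + 1)) * Lagrange.nodalWeight (Finset.range (m + 1)) v j

section DualWeight

variable {v : ℕ → ℝ} {m : ℕ}

lemma dualWeight_zero (hv0 : v 0 = 0) (hpos : ∀ j, 0 < v (j + 1)) : dualWeight v m 0 = 1 := by
  have h : (Finset.range (m + 1)).erase 0 = (Finset.range m).image (· + 1) := by
    ext i
    rcases i with _ | i <;> simp
  rw [dualWeight, Lagrange.nodalWeight, h, Finset.prod_image (by simp), ← Finset.prod_mul_distrib]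
  refine Finset.prod_eq_one fun i _ => ?_
  rw [hv0, zero_sub]
  exact mul_inv_cancel₀ (neg_ne_zero.2 (hpos i).ne')

lemma sum_dualWeight_mul_pow (hinj : Function.Injective v) {k : ℕ} (hk : k < m) :
    ∑ j ∈ Finset.range (m + 1), dualWeight v m j * v j ^ k = 0 := by
  have h := Lagrange.coeff_eq_sum (s := Finset.range (m + 1)) (v := v) hinj.injOn
    (P := Polynomial.X ^ k) (by
      rw [Polynomial.degree_X_pow, Finset.card_range]
      exact_mod_cast hk.trans (Nat.lt_succ_self m))
  rw [Polynomial.coeff_X_pow, Finset.card_range, Nat.add_sub_cancel, if_neg hk.ne'] at h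
  have h2 : ∑ j ∈ Finset.range (m + 1), dualWeight v m j * v j ^ k =
      (∏ i ∈ Finset.range m, -v (i + 1)) * ∑ j ∈ Finset.range (m + 1),
        (Polynomial.X ^ k : Polynomial ℝ).eval (v j) /
          ∏ i ∈ (Finset.range (m + 1)).erase j, (v j - v i) := by
    rw [Finset.mul_sum]
    refine Finset.sum_congr rfl fun j _ => ?_
    rw [dualWeight, Lagrange.nodalWeight, Finset.prod_inv_distrib, Polynomial.eval_pow,
      Polynomial.eval_X]
    ring
  rw [h2, ← h, mul_zero]

lemma abs_dualWeight_succ (hv0 : v 0 = 0) (hpos : ∀ j, 0 < v (j + 1)) {j : ℕ} (hj : j < m) :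
    |dualWeight v m (j + 1)| = ∏ i ∈ Finset.range m,
      if i = j then 1 else |v (i + 1) / (v (i + 1) - v (j + 1))| := by
  have h : (Finset.range (m + 1)).erase (j + 1) =
      insert 0 (((Finset.range m).erase j).image (· + 1)) := by
    ext i
    rcases i with _ | i <;> simp
  have hj' : j ∈ Finset.range m := Finset.mem_range.2 hj
  rw [dualWeight, Lagrange.nodalWeight, h, Finset.prod_insert (by simp),
    Finset.prod_image (by simp), hv0, sub_zero, abs_mul, Finset.abs_prod, abs_mul, Finset.abs_prod,
    ← Finset.mul_prod_erase _ _ hj', ← Finset.mul_prod_erase _ _ hj', if_pos rfl, one_mul,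
    Finset.prod_congr rfl fun i hi => if_neg (Finset.ne_of_mem_erase hi)]
  have e : ∀ A B : ℝ, |-v (j + 1)| * A * (|(v (j + 1))⁻¹| * B) = A * B := fun A B => by
    have : v (j + 1) ≠ 0 := (hpos j).ne'
    rw [abs_neg, abs_inv]
    field_simp
  rw [e, ← Finset.prod_mul_distrib]
  refine Finset.prod_congr rfl fun i _ => ?_
  rw [abs_neg, abs_inv, abs_div, abs_sub_comm]
  rfl

lemma sum_dualWeight_div_add (hv0 : v 0 = 0) (hpos : ∀ j, 0 < v (j + 1))
    (hinj : Function.Injective v) {t : ℝ} (ht : 0 < t) :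
    ∑ j ∈ Finset.range (m + 1), dualWeight v m j / (v j + t) =
      (∏ i ∈ Finset.range m, v (i + 1) / (v (i + 1) + t)) / t := by
  have hvt : ∀ j, 0 < v j + t := by
    rintro (_ | j)
    · rw [hv0]; linarith
    · linarith [hpos j]
  have hx : ∀ i ∈ Finset.range (m + 1), -t ≠ v i := fun i _ h => by linarith [hvt i]
  have h := Lagrange.eval_interpolate_not_at_node (s := Finset.range (m + 1)) (v := v)
    (x := -t) 1 hx
  rw [Lagrange.interpolate_one hinj.injOn (by simp), Polynomial.eval_one, Lagrange.eval_nodal,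
    Finset.prod_range_succ', hv0, sub_zero] at h
  have h2 : ∑ j ∈ Finset.range (m + 1), dualWeight v m j / (v j + t) =
      -(∏ i ∈ Finset.range m, -v (i + 1)) * ∑ i ∈ Finset.range (m + 1),
        Lagrange.nodalWeight (Finset.range (m + 1)) v i * (-t - v i)⁻¹ * (1 : ℕ → ℝ) i := by
    rw [Finset.mul_sum]
    refine Finset.sum_congr rfl fun j _ => ?_
    rw [dualWeight, show -t - v j = -(v j + t) by ring, inv_neg, Pi.one_apply]
    ring
  rw [h2]
  set Q := ∑ i ∈ Finset.range (m + 1),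
    Lagrange.nodalWeight (Finset.range (m + 1)) v i * (-t - v i)⁻¹ * (1 : ℕ → ℝ) i
  have hprod : (∏ k ∈ Finset.range m, (-t - v (k + 1))) =
      ∏ k ∈ Finset.range m, -(v (k + 1) + t) := Finset.prod_congr rfl fun k _ => by ring
  rw [hprod] at h
  have hne : (∏ k ∈ Finset.range m, -(v (k + 1) + t)) ≠ 0 :=
    Finset.prod_ne_zero_iff.2 fun k _ => neg_ne_zero.2 (hvt _).ne'
  have hQ : Q = -(1 / (t * ∏ k ∈ Finset.range m, -(v (k + 1) + t))) := by
    field_simp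
    linarith
  have hdiv : ∏ i ∈ Finset.range m, v (i + 1) / (v (i + 1) + t) =
      (∏ i ∈ Finset.range m, -v (i + 1)) / ∏ k ∈ Finset.range m, -(v (k + 1) + t) := by
    rw [← Finset.prod_div_distrib]
    exact Finset.prod_congr rfl fun i _ => (neg_div_neg_eq _ _).symm
  rw [hQ, hdiv]
  field_simp

lemma le_sum_dualWeight_mul_log (hv0 : v 0 = 0) (hpos : ∀ j, 0 < v (j + 1))
    (hinj : Function.Injective v) (hm : 2 ≤ m) :
    ∏ i ∈ Finset.range m, v (i + 1) / (v (i + 1) + 1) ≤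
      ∑ j ∈ Finset.range (m + 1), dualWeight v m j * (v j * Real.log (v j)) := by
  have hvnn : ∀ j, 0 ≤ v j := by
    rintro (_ | j)
    · rw [hv0]
    · exact (hpos j).le
  have hsum0 : ∑ j ∈ Finset.range (m + 1), dualWeight v m j = 0 := by
    simpa using sum_dualWeight_mul_pow hinj (k := 0) (by omega : 0 < m)
  have hsum1 : ∑ j ∈ Finset.range (m + 1), dualWeight v m j * v j = 0 := by
    simpa using sum_dualWeight_mul_pow hinj (k := 1) (by omega : 1 < m)
  set G : ℝ → ℝ := fun t => ∑ j ∈ Finset.range (m + 1),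
    dualWeight v m j * (v j * Real.log (v j + t)) with hG
  set pr : ℝ → ℝ := fun t => ∏ i ∈ Finset.range m, v (i + 1) / (v (i + 1) + t) with hpr
  have hd : ∀ t, 0 < t → HasDerivAt G (-pr t) t := by
    intro t ht
    have h := HasDerivAt.fun_sum (u := Finset.range (m + 1)) fun j _ =>
      ((((hasDerivAt_id t).const_add (v j)).log (by
        have := hvnn j; simp only [id]; linarith)).const_mul (v j)).const_mul (dualWeight v m j)
    refine h.congr_deriv ?_
    have e := sum_dualWeight_div_add (m := m) hv0 hpos hinj ht
    rw [eq_div_iff ht.ne'] at e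
    rw [hpr]
    simp only
    rw [← e, Finset.sum_mul, ← zero_sub, ← hsum0, ← Finset.sum_sub_distrib]
    refine Finset.sum_congr rfl fun j _ => ?_
    have : v j + t ≠ 0 := by linarith [hvnn j]
    simp only [id]
    field_simp
    ring
  have hprpos : ∀ t, 0 ≤ t → 0 < pr t := fun t ht =>
    Finset.prod_pos fun i _ => div_pos (hpos i) (by linarith [hpos i])
  have hcont : ContinuousOn G (Set.Ici 0) := by
    refine continuousOn_finsetSum _ fun j _ => ?_
    refine continuousOn_const.mul ?_
    rcases j with _ | j
    · simp only [hv0, zero_mul]; exact continuousOn_const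
    · refine continuousOn_const.mul (ContinuousOn.log (by fun_prop) fun t ht => ?_)
      have : (0 : ℝ) ≤ t := ht
      linarith [hpos j]
  have hlim : Filter.Tendsto G Filter.atTop (nhds 0) := by
    have h : Filter.Tendsto (fun t => ∑ j ∈ Finset.range (m + 1),
        dualWeight v m j * (v j * Real.log (v j / t + 1))) Filter.atTop
        (nhds (∑ j ∈ Finset.range (m + 1), dualWeight v m j * (v j * Real.log (0 + 1)))) := by
      refine tendsto_finsetSum _ fun j _ =>
        Filter.Tendsto.const_mul _ (Filter.Tendsto.const_mul _ ?_)
      refine Filter.Tendsto.log (Filter.Tendsto.add_const _ ?_) (by norm_num)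
      exact tendsto_const_nhds.div_atTop Filter.tendsto_id
    simp only [zero_add, Real.log_one, mul_zero, Finset.sum_const_zero] at h
    refine h.congr' ?_
    filter_upwards [Filter.eventually_gt_atTop 0] with t ht
    have e : ∀ j, Real.log (v j / t + 1) = Real.log (v j + t) - Real.log t := fun j => by
      have := hvnn j
      rw [← Real.log_div (by positivity) ht.ne', add_div, div_self ht.ne']
    simp only [hG, e, mul_sub, Finset.sum_sub_distrib]
    rw [sub_eq_self]
    simp only [← mul_assoc, ← Finset.sum_mul, hsum1, zero_mul]
  have hG1 : 0 ≤ G 1 := by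
    have hanti : AntitoneOn G (Set.Ici 1) := by
      refine antitoneOn_of_hasDerivWithinAt_nonpos (convex_Ici 1) (f' := fun t => -pr t)
        (hcont.mono (Set.Ici_subset_Ici.2 zero_le_one)) ?_ ?_
      · intro t ht
        rw [interior_Ici] at ht
        exact (hd t (zero_lt_one.trans ht)).hasDerivWithinAt
      · intro t ht
        rw [interior_Ici] at ht
        linarith [hprpos t (zero_lt_one.trans ht).le]
    exact le_of_tendsto hlim (by
      filter_upwards [Filter.eventually_ge_atTop 1] with t ht
      exact hanti (Set.mem_Ici.2 le_rfl) ht ht)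
  have hanti : AntitoneOn (fun t => G t + pr 1 * t) (Set.Icc 0 1) := by
    refine antitoneOn_of_hasDerivWithinAt_nonpos (convex_Icc 0 1)
      (f' := fun t => -pr t + pr 1 * 1)
      ((hcont.mono Set.Icc_subset_Ici_self).add (by fun_prop)) ?_ ?_
    · intro t ht
      rw [interior_Icc] at ht
      exact ((hd t ht.1).add ((hasDerivAt_id t).const_mul (pr 1))).hasDerivWithinAt
    · intro t ht
      rw [interior_Icc] at ht
      have : pr 1 ≤ pr t := by
        refine Finset.prod_le_prod (fun i _ => ?_) fun i _ => ?_
        · have := hpos i; positivity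
        · have := hpos i
          have := ht.1
          gcongr
          exact ht.2.le
      linarith
  have h01 := hanti (Set.left_mem_Icc.2 zero_le_one) (Set.right_mem_Icc.2 zero_le_one) zero_le_one
  simp only [mul_one, mul_zero, add_zero] at h01
  have hG0 : G 0 = ∑ j ∈ Finset.range (m + 1), dualWeight v m j * (v j * Real.log (v j)) := by
    simp [hG]
  rw [← hG0]
  linarith

end DualWeight

/-- Nodes `0, 1, 2, 4, 16, 36, …, 4 k ^ 2, …`. -/
def quadNode : ℕ → ℝ
  | 0 => 0
  | 1 => 1
  | 2 => 2
  | k + 3 => 4 * ((k : ℝ) + 1) ^ 2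

lemma quadNode_lt_succ (j : ℕ) : quadNode j < quadNode (j + 1) := by
  match j with
  | 0 => norm_num [quadNode]
  | 1 => norm_num [quadNode]
  | 2 => norm_num [quadNode]
  | k + 3 =>
    simp only [quadNode]
    push_cast
    nlinarith [(Nat.cast_nonneg k : (0 : ℝ) ≤ k)]

lemma quadNode_strictMono : StrictMono quadNode := strictMono_nat_of_lt_succ quadNode_lt_succ

lemma quadNode_succ_pos (j : ℕ) : 0 < quadNode (j + 1) :=
  quadNode_strictMono (Nat.succ_pos j)

lemma one_le_quadNode_succ (j : ℕ) : 1 ≤ quadNode (j + 1) := by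
  have h := quadNode_strictMono.monotone (show 1 ≤ j + 1 by omega)
  simpa [quadNode] using h

lemma quadNode_le {N j : ℕ} (hN : 1 ≤ N) (hj : j < N + 3) : quadNode j ≤ 4 * (N : ℝ) ^ 2 := by
  obtain ⟨k, rfl⟩ : ∃ k, N = k + 1 := ⟨N - 1, by omega⟩
  have h := quadNode_strictMono.monotone (show j ≤ k + 3 by omega)
  simpa [quadNode] using h

lemma prod_sq_div_sub_one_le (N : ℕ) :
    ∏ i ∈ Finset.range N, 4 * ((i : ℝ) + 1) ^ 2 / (4 * ((i : ℝ) + 1) ^ 2 - 1) ≤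
      (2 * (N : ℝ) + 1) / (N + 1) := by
  induction N with
  | zero => simp
  | succ N ih =>
    rw [Finset.prod_range_succ]
    have h0 : (0 : ℝ) ≤ N := Nat.cast_nonneg N
    have h1 : 0 < 4 * ((N : ℝ) + 1) ^ 2 - 1 := by nlinarith
    refine (mul_le_mul_of_nonneg_right ih (by positivity)).trans ?_
    push_cast
    rw [div_mul_div_comm, div_le_div_iff₀ (by positivity) (by positivity)]
    nlinarith [pow_nonneg h0 2, pow_nonneg h0 3, pow_nonneg h0 4]

lemma prod_sq_div_sub_two_le (N : ℕ) :
    ∏ i ∈ Finset.range N, 4 * ((i : ℝ) + 1) ^ 2 / (4 * ((i : ℝ) + 1) ^ 2 - 2) ≤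
      (4 * (N : ℝ) + 1) / (N + 1) := by
  induction N with
  | zero => simp
  | succ N ih =>
    rw [Finset.prod_range_succ]
    have h0 : (0 : ℝ) ≤ N := Nat.cast_nonneg N
    have h1 : 0 < 4 * ((N : ℝ) + 1) ^ 2 - 2 := by nlinarith
    refine (mul_le_mul_of_nonneg_right ih (by positivity)).trans ?_
    push_cast
    rw [div_mul_div_comm, div_le_div_iff₀ (by positivity) (by positivity)]
    nlinarith [pow_nonneg h0 2, pow_nonneg h0 3, pow_nonneg h0 4]

lemma le_prod_sq_div_add_one (N : ℕ) :
    ((N : ℝ) + 2) / (2 * (N + 1)) ≤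
      ∏ i ∈ Finset.range N, 4 * ((i : ℝ) + 1) ^ 2 / (4 * ((i : ℝ) + 1) ^ 2 + 1) := by
  induction N with
  | zero => norm_num
  | succ N ih =>
    rw [Finset.prod_range_succ]
    have h0 : (0 : ℝ) ≤ N := Nat.cast_nonneg N
    refine le_trans ?_ (mul_le_mul_of_nonneg_right ih (by positivity))
    push_cast
    rw [div_mul_div_comm, div_le_div_iff₀ (by positivity) (by positivity)]
    nlinarith [pow_nonneg h0 2, pow_nonneg h0 3, pow_nonneg h0 4]

lemma prod_div_abs_sub_eq_choose (j k : ℕ) :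
    ∏ i ∈ Finset.range (j + 1 + k), (if i = j then (1 : ℝ) else ((i : ℝ) + 1) / |(i : ℝ) - j|) =
      (j + 1 + k).choose (j + 1) := by
  induction k with
  | zero =>
    rw [add_zero, Nat.choose_self, Finset.prod_range_succ, if_pos rfl, mul_one,
      Finset.prod_congr rfl (g := fun i : ℕ => ((i : ℝ) + 1) / ((j - 1 - i : ℕ) + 1)) ?_,
      Finset.prod_div_distrib, Finset.prod_range_reflect (fun i : ℕ => (i : ℝ) + 1), div_self]
    · simp
    · exact Finset.prod_ne_zero_iff.2 fun i _ => by positivity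
    · intro i hi
      have h := Finset.mem_range.1 hi
      rw [if_neg h.ne, abs_sub_comm, abs_of_pos (sub_pos.2 (Nat.cast_lt.2 h))]
      have : (j - 1 - i : ℕ) + 1 = j - i := by omega
      rw [← Nat.cast_add_one (j - 1 - i), this, Nat.cast_sub h.le]
  | succ k ih =>
    rw [← add_assoc, Finset.prod_range_succ, ih, if_neg (by omega)]
    have h := Nat.choose_mul_succ_eq (j + 1 + k) (j + 1)
    rw [show j + 1 + k + 1 - (j + 1) = k + 1 by omega] at h
    have h' : ((j + 1 + k).choose (j + 1) : ℝ) * (j + 1 + k + 1) =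
        ((j + 1 + k + 1).choose (j + 1) : ℝ) * (k + 1) := by exact_mod_cast h
    have e : ((j + 1 + k : ℕ) : ℝ) - j = k + 1 := by push_cast; ring
    rw [e, abs_of_pos (by positivity), ← mul_div_assoc, div_eq_iff (by positivity), ← h']
    push_cast
    ring

lemma choose_mul_prod_div_add (j N : ℕ) :
    ((N + (j + 1)).choose (j + 1) : ℝ) * ∏ i ∈ Finset.range N,
      (if i = j then (1 : ℝ) else ((i : ℝ) + 1) / (i + j + 2)) = if j < N then (2 : ℝ) else 1 := by
  induction N with
  | zero => simp
  | succ N ih =>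
    rw [Finset.prod_range_succ, ← mul_assoc]
    have h := Nat.choose_mul_succ_eq (N + (j + 1)) (j + 1)
    rw [show N + (j + 1) + 1 - (j + 1) = N + 1 by omega,
      show N + (j + 1) + 1 = N + 1 + (j + 1) by omega] at h
    have h' : ((N + (j + 1)).choose (j + 1) : ℝ) * (N + 1 + (j + 1)) =
        ((N + 1 + (j + 1)).choose (j + 1) : ℝ) * (N + 1) := by exact_mod_cast h
    have e : ((N + 1 + (j + 1)).choose (j + 1) : ℝ) =
        ((N + (j + 1)).choose (j + 1) : ℝ) * ((N + 1 + (j + 1)) / (N + 1)) := by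
      rw [← mul_div_assoc, h', mul_div_assoc, div_self (by positivity), mul_one]
    rw [e]
    have ih' := ih
    set Q := ∏ i ∈ Finset.range N, (if i = j then (1 : ℝ) else ((i : ℝ) + 1) / (i + j + 2))
    have e2 : ∀ a b c : ℝ, a * b * Q * c = a * Q * (b * c) := fun a b c => by ring
    rw [e2, ih']
    have hN : (0 : ℝ) < N + 1 := by positivity
    rcases lt_trichotomy N j with h | h | h
    · rw [if_neg h.not_gt, if_neg h.ne, if_neg (by omega), one_mul]
      field_simp
      ring
    · subst h
      rw [if_neg (by omega), if_pos rfl, if_pos (by omega)]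
      field_simp
      ring
    · rw [if_pos h, if_neg h.ne', if_pos (by omega)]
      field_simp
      ring

lemma prod_sq_div_abs_sub_sq_le {j N : ℕ} (hj : j < N) :
    ∏ i ∈ Finset.range N, (if i = j then (1 : ℝ) else
      |4 * ((i : ℝ) + 1) ^ 2 / (4 * ((i : ℝ) + 1) ^ 2 - 4 * ((j : ℝ) + 1) ^ 2)|) ≤ 2 := by
  obtain ⟨k, rfl⟩ : ∃ k, N = j + 1 + k := ⟨N - (j + 1), by omega⟩
  have e : ∏ i ∈ Finset.range (j + 1 + k), (if i = j then (1 : ℝ) else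
      |4 * ((i : ℝ) + 1) ^ 2 / (4 * ((i : ℝ) + 1) ^ 2 - 4 * ((j : ℝ) + 1) ^ 2)|) =
      (∏ i ∈ Finset.range (j + 1 + k),
        (if i = j then (1 : ℝ) else ((i : ℝ) + 1) / |(i : ℝ) - j|)) *
      ∏ i ∈ Finset.range (j + 1 + k),
        (if i = j then (1 : ℝ) else ((i : ℝ) + 1) / (i + j + 2)) := by
    rw [← Finset.prod_mul_distrib]
    refine Finset.prod_congr rfl fun i _ => ?_
    split_ifs with h
    · rw [mul_one]
    · have hne : (i : ℝ) - j ≠ 0 := sub_ne_zero.2 (Nat.cast_injective.ne h)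
      have hp : (0 : ℝ) < i + j + 2 := by positivity
      have e1 : 4 * ((i : ℝ) + 1) ^ 2 - 4 * ((j : ℝ) + 1) ^ 2 =
          4 * (((i : ℝ) - j) * (i + j + 2)) := by ring
      rw [e1, mul_div_mul_left _ _ (by norm_num), abs_div, abs_mul, abs_of_pos hp, abs_pow, sq,
        abs_of_pos (by positivity : (0 : ℝ) < (i : ℝ) + 1), div_mul_div_comm]
  have h2 := choose_mul_prod_div_add j (j + 1 + k)
  rw [if_pos hj] at h2
  rw [e, prod_div_abs_sub_eq_choose]
  refine le_of_le_of_eq (mul_le_mul_of_nonneg_right ?_ ?_) h2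
  · exact_mod_cast Nat.choose_le_choose _ (Nat.le_add_right (j + 1 + k) (j + 1))
  · refine Finset.prod_nonneg fun i _ => ?_
    split_ifs <;> positivity

section Weights

variable (N : ℕ)

lemma abs_dualWeight_one_le : |dualWeight quadNode (N + 2) 1| ≤ 4 := by
  rw [abs_dualWeight_succ (j := 0) rfl quadNode_succ_pos (by omega), Finset.prod_range_succ',
    Finset.prod_range_succ']
  have h := prod_sq_div_sub_one_le N
  have h' : (2 * (N : ℝ) + 1) / (N + 1) ≤ 2 := by
    rw [div_le_iff₀ (by positivity)]; linarith
  have e : ∏ i ∈ Finset.range N, (if i + 1 + 1 = 0 then (1 : ℝ) else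
      |quadNode (i + 1 + 1 + 1) / (quadNode (i + 1 + 1 + 1) - quadNode (0 + 1))|) =
      ∏ i ∈ Finset.range N, 4 * ((i : ℝ) + 1) ^ 2 / (4 * ((i : ℝ) + 1) ^ 2 - 1) := by
    refine Finset.prod_congr rfl fun i _ => ?_
    rw [if_neg (by omega)]
    simp only [quadNode]
    have : 0 < 4 * ((i : ℝ) + 1) ^ 2 - 1 := by nlinarith [(Nat.cast_nonneg i : (0 : ℝ) ≤ i)]
    exact abs_of_nonneg (by positivity)
  rw [e]
  refine (mul_le_mul_of_nonneg_right (mul_le_mul_of_nonneg_right (h.trans h') ?_) ?_).trans ?_ <;>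
    norm_num [quadNode]

lemma abs_dualWeight_two_le : |dualWeight quadNode (N + 2) 2| ≤ 4 := by
  rw [abs_dualWeight_succ (j := 1) rfl quadNode_succ_pos (by omega), Finset.prod_range_succ',
    Finset.prod_range_succ']
  have h := prod_sq_div_sub_two_le N
  have h' : (4 * (N : ℝ) + 1) / (N + 1) ≤ 4 := by
    rw [div_le_iff₀ (by positivity)]; linarith
  have e : ∏ i ∈ Finset.range N, (if i + 1 + 1 = 1 then (1 : ℝ) else
      |quadNode (i + 1 + 1 + 1) / (quadNode (i + 1 + 1 + 1) - quadNode (1 + 1))|) =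
      ∏ i ∈ Finset.range N, 4 * ((i : ℝ) + 1) ^ 2 / (4 * ((i : ℝ) + 1) ^ 2 - 2) := by
    refine Finset.prod_congr rfl fun i _ => ?_
    rw [if_neg (by omega)]
    simp only [quadNode]
    have : 0 < 4 * ((i : ℝ) + 1) ^ 2 - 2 := by nlinarith [(Nat.cast_nonneg i : (0 : ℝ) ≤ i)]
    exact abs_of_nonneg (by positivity)
  rw [e]
  refine (mul_le_mul_of_nonneg_right (mul_le_mul_of_nonneg_right (h.trans h') ?_) ?_).trans ?_ <;>
    norm_num [quadNode]

lemma abs_dualWeight_add_three_le {j : ℕ} (hj : j < N) :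
    |dualWeight quadNode (N + 2) (j + 3)| ≤ 2 / (3 * ((j : ℝ) + 1) ^ 4) := by
  rw [abs_dualWeight_succ (j := j + 2) rfl quadNode_succ_pos (by omega), Finset.prod_range_succ',
    Finset.prod_range_succ']
  have h := prod_sq_div_abs_sub_sq_le hj
  have e : ∏ i ∈ Finset.range N, (if i + 1 + 1 = j + 2 then (1 : ℝ) else
      |quadNode (i + 1 + 1 + 1) / (quadNode (i + 1 + 1 + 1) - quadNode (j + 2 + 1))|) =
      ∏ i ∈ Finset.range N, (if i = j then (1 : ℝ) else
      |4 * ((i : ℝ) + 1) ^ 2 / (4 * ((i : ℝ) + 1) ^ 2 - 4 * ((j : ℝ) + 1) ^ 2)|) := by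
    refine Finset.prod_congr rfl fun i _ => ?_
    simp only [quadNode, show (i + 1 + 1 = j + 2) ↔ i = j by omega]
  rw [e, if_neg (by omega), if_neg (by omega)]
  set u := ((j : ℝ) + 1) ^ 2 with hu
  have hu1 : 1 ≤ u := by
    rw [hu]; nlinarith [(Nat.cast_nonneg j : (0 : ℝ) ≤ j)]
  have e1 : |quadNode (0 + 1 + 1) / (quadNode (0 + 1 + 1) - quadNode (j + 2 + 1))| =
      2 / (4 * u - 2) := by
    simp only [quadNode, ← hu]
    rw [abs_div, abs_of_pos (by norm_num : (0 : ℝ) < 2), abs_sub_comm, abs_of_pos (by linarith)]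
  have e2 : |quadNode (0 + 1) / (quadNode (0 + 1) - quadNode (j + 2 + 1))| =
      1 / (4 * u - 1) := by
    simp only [quadNode, ← hu]
    rw [abs_div, abs_one, abs_sub_comm, abs_of_pos (by linarith)]
  rw [e1, e2, show ((j : ℝ) + 1) ^ 4 = u ^ 2 by rw [hu]; ring]
  have p1 : 0 < 4 * u - 2 := by linarith
  have p2 : 0 < 4 * u - 1 := by linarith
  have hstep : 2 / (4 * u - 2) ≤ 1 / u := by
    rw [div_le_div_iff₀ p1 (by linarith)]; linarith
  have hstep2 : 1 / (4 * u - 1) ≤ 1 / (3 * u) := by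
    rw [div_le_div_iff₀ p2 (by linarith)]; linarith
  calc _ ≤ 2 * (1 / u) * (1 / (3 * u)) := by gcongr
    _ = 2 / (3 * u ^ 2) := by field_simp

lemma sum_one_div_sq_le : ∑ i ∈ Finset.range N, 1 / ((i : ℝ) + 1) ^ 2 ≤ 2 - 1 / (N : ℝ) := by
  induction N with
  | zero => norm_num
  | succ N ih =>
    rw [Finset.sum_range_succ]
    rcases Nat.eq_zero_or_pos N with rfl | hN
    · norm_num
    · push_cast
      have hN' : (0 : ℝ) < N := Nat.cast_pos.2 hN
      have h : 1 / ((N : ℝ) + 1) ^ 2 ≤ 1 / N - 1 / (N + 1) := by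
        rw [div_sub_div _ _ hN'.ne' (by positivity),
          div_le_div_iff₀ (by positivity) (by positivity)]
        nlinarith
      linarith

end Weights

/-- Two priors on `N + 3` nodes matching `N + 1` moments whose means of `x log x` are separated. -/
theorem exists_matching_priors {N : ℕ} (hN : 1 ≤ N) :
    ∃ x p q : Fin (N + 3) → ℝ, (∀ j, x j = 0 ∨ 1 ≤ x j) ∧ (∀ j, x j ≤ 4 * (N : ℝ) ^ 2) ∧
      (∀ j, 0 ≤ p j) ∧ (∀ j, 0 ≤ q j) ∧ ∑ j, p j = 1 ∧ ∑ j, q j = 1 ∧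
      (∀ k < N + 2, ∑ j, p j * x j ^ k = ∑ j, q j * x j ^ k) ∧
      ∑ j, p j * x j ≤ 18 ∧ ∑ j, p j * x j ^ 2 ≤ 31 * N ∧
      1 / 33 ≤ ∑ j, p j * (x j * Real.log (x j)) - ∑ j, q j * (x j * Real.log (x j)) := by
  set ν : ℕ → ℝ := dualWeight quadNode (N + 2) with hν
  have hN' : (1 : ℝ) ≤ N := by exact_mod_cast hN
  have hsplit : ∀ f : ℕ → ℝ, (∀ k, 0 ≤ f k) → ∑ j ∈ Finset.range (N + 3), |ν j| * f j ≤
      f 0 + 4 * f 1 + 4 * f 2 +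
        ∑ j ∈ Finset.range N, 2 / (3 * ((j : ℝ) + 1) ^ 4) * f (j + 3) := by
    intro f hf
    rw [Finset.sum_range_succ', Finset.sum_range_succ', Finset.sum_range_succ']
    have h0 : |ν 0| = 1 := by rw [hν, dualWeight_zero rfl quadNode_succ_pos, abs_one]
    have h1 := mul_le_mul_of_nonneg_right (abs_dualWeight_one_le N) (hf 1)
    have h2 := mul_le_mul_of_nonneg_right (abs_dualWeight_two_le N) (hf 2)
    have h3 : ∑ j ∈ Finset.range N, |ν (j + 1 + 1 + 1)| * f (j + 1 + 1 + 1) ≤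
        ∑ j ∈ Finset.range N, 2 / (3 * ((j : ℝ) + 1) ^ 4) * f (j + 3) :=
      Finset.sum_le_sum fun j hj => mul_le_mul_of_nonneg_right
        (abs_dualWeight_add_three_le N (Finset.mem_range.1 hj)) (hf _)
    simp only [zero_add, h0, one_mul, Nat.reduceAdd]
    linarith
  have hsq : ∑ i ∈ Finset.range N, 1 / ((i : ℝ) + 1) ^ 2 ≤ 2 :=
    (sum_one_div_sq_le N).trans (by have : (0 : ℝ) ≤ 1 / N := by positivity
                                    linarith)
  have hquad : ∑ j ∈ Finset.range N, 1 / ((j : ℝ) + 1) ^ 4 ≤ 2 := by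
    refine (Finset.sum_le_sum fun i _ => ?_).trans hsq
    refine one_div_le_one_div_of_le (by positivity) (pow_le_pow_right₀ ?_ (by norm_num))
    linarith [(Nat.cast_nonneg i : (0 : ℝ) ≤ i)]
  have habs0 : ∑ j ∈ Finset.range (N + 3), |ν j| ≤ 11 := by
    have h := hsplit (fun _ => 1) fun _ => zero_le_one
    have e : ∑ j ∈ Finset.range N, 2 / (3 * ((j : ℝ) + 1) ^ 4) * 1 =
        2 / 3 * ∑ j ∈ Finset.range N, 1 / ((j : ℝ) + 1) ^ 4 := by
      rw [Finset.mul_sum]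
      exact Finset.sum_congr rfl fun j _ => by field_simp
    simp only [e] at h
    simp only [mul_one] at h
    linarith
  have habs1 : ∑ j ∈ Finset.range (N + 3), |ν j| * quadNode j ≤ 18 := by
    have h := hsplit quadNode fun k => by
      simpa [quadNode] using quadNode_strictMono.monotone (Nat.zero_le k)
    have e : ∑ j ∈ Finset.range N, 2 / (3 * ((j : ℝ) + 1) ^ 4) * quadNode (j + 3) =
        8 / 3 * ∑ j ∈ Finset.range N, 1 / ((j : ℝ) + 1) ^ 2 := by
      rw [Finset.mul_sum]
      refine Finset.sum_congr rfl fun j _ => ?_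
      simp only [quadNode]
      field_simp
      ring
    rw [e] at h
    simp only [quadNode] at h ⊢
    linarith
  have habs2 : ∑ j ∈ Finset.range (N + 3), |ν j| * quadNode j ^ 2 ≤ 31 * N := by
    have h := hsplit (fun j => quadNode j ^ 2) fun k => sq_nonneg _
    have e : ∑ j ∈ Finset.range N, 2 / (3 * ((j : ℝ) + 1) ^ 4) * quadNode (j + 3) ^ 2 =
        32 / 3 * (N : ℝ) := by
      rw [Finset.sum_congr rfl (g := fun _ => (32 / 3 : ℝ)) fun j _ => by
        simp only [quadNode]
        field_simp
        ring]
      simp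
      ring
    simp only [e] at h
    simp only [quadNode] at h ⊢
    linarith
  have hsum : ∀ k < N + 2, ∑ j ∈ Finset.range (N + 3), ν j * quadNode j ^ k = 0 := fun k hk =>
    sum_dualWeight_mul_pow quadNode_strictMono.injective hk
  have hlog : 1 / 6 ≤ ∑ j ∈ Finset.range (N + 3), ν j * (quadNode j * Real.log (quadNode j)) := by
    refine le_trans ?_ (le_sum_dualWeight_mul_log rfl quadNode_succ_pos
      quadNode_strictMono.injective (by omega))
    rw [Finset.prod_range_succ', Finset.prod_range_succ']
    have h : (1 / 2 : ℝ) ≤ ∏ k ∈ Finset.range N,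
        quadNode (k + 1 + 1 + 1) / (quadNode (k + 1 + 1 + 1) + 1) := by
      refine le_trans ?_ (le_prod_sq_div_add_one N)
      rw [div_le_div_iff₀ (by norm_num) (by positivity)]
      linarith
    refine le_trans ?_ (mul_le_mul_of_nonneg_right (mul_le_mul_of_nonneg_right h ?_) ?_) <;>
      norm_num [quadNode]
  set V : ℝ := ∑ j ∈ Finset.range (N + 3), max (ν j) 0 with hV
  have hmax : ∀ t : ℝ, max t 0 - max (-t) 0 = t := fun t => by
    rcases le_total t 0 with h | h
    · rw [max_eq_right h, max_eq_left (by linarith)]; ring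
    · rw [max_eq_left h, max_eq_right (by linarith)]; ring
  have hdiff : ∀ f : ℕ → ℝ, ∑ j ∈ Finset.range (N + 3), max (ν j) 0 * f j -
      ∑ j ∈ Finset.range (N + 3), max (-ν j) 0 * f j = ∑ j ∈ Finset.range (N + 3), ν j * f j := by
    intro f
    rw [← Finset.sum_sub_distrib]
    exact Finset.sum_congr rfl fun j _ => by rw [← sub_mul, hmax]
  have hV' : ∑ j ∈ Finset.range (N + 3), max (-ν j) 0 = V := by
    have h := hdiff fun _ => 1
    have h0 := hsum 0 (by omega)
    simp only [mul_one, pow_zero] at h h0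
    linarith
  have hV1 : 1 ≤ V := by
    refine le_trans ?_ (Finset.single_le_sum (f := fun j => max (ν j) 0)
      (fun j _ => le_max_right _ _) (Finset.mem_range.2 (by omega : 0 < N + 3)))
    rw [hν]
    simp only [dualWeight_zero rfl quadNode_succ_pos]
    norm_num
  have hV2 : V + V ≤ 11 := by
    nth_rewrite 2 [← hV']
    rw [hV, ← Finset.sum_add_distrib]
    refine (Finset.sum_le_sum fun j _ => le_of_eq ?_).trans habs0
    rcases le_total (ν j) 0 with h | h
    · rw [max_eq_right h, max_eq_left (by linarith), abs_of_nonpos h]; ring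
    · rw [max_eq_left h, max_eq_right (by linarith), abs_of_nonneg h]; ring
  have hVpos : 0 < V := by linarith
  have hmean : ∀ f : ℕ → ℝ, (∀ j, 0 ≤ f j) →
      ∑ j ∈ Finset.range (N + 3), max (ν j) 0 / V * f j ≤
        ∑ j ∈ Finset.range (N + 3), |ν j| * f j := by
    refine fun f hf => Finset.sum_le_sum fun j _ => mul_le_mul_of_nonneg_right ?_ (hf j)
    refine (div_le_self (le_max_right _ _) hV1).trans (max_le (le_abs_self _) (abs_nonneg _))
  have hdiff' : ∀ f : ℕ → ℝ, ∑ j ∈ Finset.range (N + 3), max (ν j) 0 / V * f j -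
      ∑ j ∈ Finset.range (N + 3), max (-ν j) 0 / V * f j =
        (∑ j ∈ Finset.range (N + 3), ν j * f j) / V := by
    intro f
    rw [← hdiff, sub_div, Finset.sum_div, Finset.sum_div]
    simp only [div_mul_eq_mul_div]
  have hnode : ∀ j, 0 ≤ quadNode j := fun k => by
    simpa [quadNode] using quadNode_strictMono.monotone (Nat.zero_le k)
  refine ⟨fun j => quadNode j, fun j => max (ν j) 0 / V, fun j => max (-ν j) 0 / V, ?_,
    fun j => quadNode_le hN j.2, fun j => by positivity, fun j => by positivity, ?_, ?_, ?_, ?_,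
    ?_, ?_⟩
  · rintro ⟨_ | j, hj⟩
    · exact Or.inl rfl
    · exact Or.inr (one_le_quadNode_succ j)
  · rw [← Finset.sum_range fun j => max (ν j) 0 / V, ← Finset.sum_div, div_self hVpos.ne']
  · rw [← Finset.sum_range fun j => max (-ν j) 0 / V, ← Finset.sum_div, hV', div_self hVpos.ne']
  · intro k hk
    rw [← Finset.sum_range fun j => max (ν j) 0 / V * quadNode j ^ k,
      ← Finset.sum_range fun j => max (-ν j) 0 / V * quadNode j ^ k, ← sub_eq_zero, hdiff',
      hsum k hk, zero_div]
  · rw [← Finset.sum_range fun j => max (ν j) 0 / V * quadNode j]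
    exact (hmean _ hnode).trans habs1
  · rw [← Finset.sum_range fun j => max (ν j) 0 / V * quadNode j ^ 2]
    exact (hmean (fun j => quadNode j ^ 2) fun j => sq_nonneg _).trans habs2
  · rw [← Finset.sum_range fun j => max (ν j) 0 / V * (quadNode j * Real.log (quadNode j)),
      ← Finset.sum_range fun j => max (-ν j) 0 / V * (quadNode j * Real.log (quadNode j)),
      hdiff' fun j => quadNode j * Real.log (quadNode j), le_div_iff₀ hVpos]
    linarith

section Prior

variable {κ : Type*} [Fintype κ] {S : ℕ} {p : κ → ℝ}

lemma sum_pi_prod_eq_one (hp : ∑ j, p j = 1) : ∑ J : Fin S → κ, ∏ i, p (J i) = 1 := by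
  classical
  have h := hasSum_pi_prod (S := S) (f := fun _ => p) (a := fun _ => 1) fun _ => by
    simpa [hp] using hasSum_fintype p
  simpa using (hasSum_fintype _).unique h

lemma sum_pi_prod_mul_sub_sq (hp : ∑ j, p j = 1) (X : Fin S → κ → ℝ) :
    ∑ J : Fin S → κ, (∏ i, p (J i)) * (∑ i, X i (J i) - ∑ i, ∑ j, p j * X i j) ^ 2 =
      ∑ i, (∑ j, p j * X i j ^ 2 - (∑ j, p j * X i j) ^ 2) := by
  classical
  obtain ⟨h1, h2⟩ := hasSum_pi_moments (S := S) (p := fun _ => p) (X := X)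
    (m := fun i => ∑ j, p j * X i j) (s := fun i => ∑ j, p j * X i j ^ 2)
    (fun _ => by simpa [hp] using hasSum_fintype p) (fun _ => hasSum_fintype _)
    (fun _ => hasSum_fintype _)
  have e1 := (hasSum_fintype _).unique h1
  have e2 := (hasSum_fintype _).unique h2
  have e0 := sum_pi_prod_eq_one (S := S) hp
  set m := ∑ i, ∑ j, p j * X i j
  have e : ∀ J : Fin S → κ, (∏ i, p (J i)) * (∑ i, X i (J i) - m) ^ 2 =
      (∏ i, p (J i)) * (∑ i, X i (J i)) ^ 2 - 2 * m * ((∏ i, p (J i)) * ∑ i, X i (J i)) +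
        m ^ 2 * ∏ i, p (J i) := fun J => by ring
  simp only [e, Finset.sum_add_distrib, Finset.sum_sub_distrib, ← Finset.mul_sum, e0, e1, e2]
  ring

lemma hasSum_sum_mul_poi (hp : ∑ j, p j = 1) (ℓ : κ → ℝ) :
    HasSum (fun k => ∑ j, p j * poi (ℓ j) k) 1 := by
  have h := hasSum_sum fun j (_ : j ∈ Finset.univ) => (hasSum_poi (ℓ j)).mul_left (p j)
  simpa [hp] using h

lemma entropy_normalized {ℓ : Fin S → ℝ} (hℓ : ∀ i, 0 ≤ ℓ i) (hpos : 0 < ∑ i, ℓ i) :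
    entropy S (fun i => ℓ i / ∑ i, ℓ i) =
      Real.log (∑ i, ℓ i) - (∑ i, ℓ i * Real.log (ℓ i)) / ∑ i, ℓ i := by
  set L := ∑ i, ℓ i with hL
  have e : ∀ i, -(ℓ i / L * Real.log (ℓ i / L)) =
      ℓ i * (Real.log L / L) - ℓ i * Real.log (ℓ i) / L := by
    intro i
    rcases (hℓ i).eq_or_lt with h | h
    · rw [← h]; simp
    · rw [Real.log_div h.ne' hpos.ne']
      field_simp
      ring
  rw [entropy, Finset.sum_congr rfl fun i _ => e i, Finset.sum_sub_distrib, ← Finset.sum_mul,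
    ← Finset.sum_div, ← hL, mul_div_cancel₀ _ hpos.ne']

lemma sum_sq_sqrt_sub_normalized_le {n : ℝ} (hn : 0 < n) {ℓ : Fin S → ℝ} (hℓ : ∀ i, 0 ≤ ℓ i)
    (hpos : 0 < ∑ i, ℓ i) :
    ∑ i, (√(n * (ℓ i / ∑ i, ℓ i)) - √(ℓ i)) ^ 2 ≤ (∑ i, ℓ i - n) ^ 2 / n := by
  set L := ∑ i, ℓ i with hL
  have e : ∀ i, (√(n * (ℓ i / L)) - √(ℓ i)) ^ 2 = ℓ i * ((√L - √n) ^ 2 / L) := by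
    intro i
    have h1 : √(n * (ℓ i / L)) = √n * √(ℓ i) / √L := by
      rw [Real.sqrt_mul hn.le, Real.sqrt_div (hℓ i), mul_div_assoc]
    have hs : 0 < √L := Real.sqrt_pos.2 hpos
    have h2 : √n * √(ℓ i) / √L - √(ℓ i) = √(ℓ i) * ((√n - √L) / √L) := by
      field_simp
    rw [h1, h2, mul_pow, div_pow, Real.sq_sqrt (hℓ i), Real.sq_sqrt hpos.le]
    ring
  rw [Finset.sum_congr rfl fun i _ => e i, ← Finset.sum_mul, ← hL, mul_div_cancel₀ _ hpos.ne']
  exact sq_sqrt_sub_sqrt_le hpos.le hn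

lemma min_one_sq_entropy_sub_le {n L A m b g : ℝ} (hn : 0 < n) (hL : 0 < L) (hb : 1 ≤ b)
    (hA : |A| ≤ b * L) (hg : 0 < g) :
    min 1 (8 / g ^ 2 * (Real.log L - A / L - (Real.log n - m / n)) ^ 2) ≤
      (16 * (A - m) ^ 2 + 144 * b ^ 2 * (L - n) ^ 2) / (g * n) ^ 2 + 4 * (L - n) ^ 2 / n ^ 2 := by
  have h1 : 0 ≤ (16 * (A - m) ^ 2 + 144 * b ^ 2 * (L - n) ^ 2) / (g * n) ^ 2 := by positivity
  have h2 : 0 ≤ 4 * (L - n) ^ 2 / n ^ 2 := by positivity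
  rcases lt_or_ge L (n / 2) with h | h
  · refine (min_le_left _ _).trans ?_
    have : 1 ≤ 4 * (L - n) ^ 2 / n ^ 2 := by
      rw [le_div_iff₀ (by positivity)]
      nlinarith
    linarith
  · refine (min_le_right _ _).trans ?_
    have hlog : |Real.log L - Real.log n| ≤ 2 * |L - n| / n := by
      have hup : Real.log L - Real.log n ≤ (L - n) / n := by
        rw [← Real.log_div hL.ne' hn.ne']
        refine (Real.log_le_sub_one_of_pos (by positivity)).trans (le_of_eq ?_)
        field_simp
      have hlo : Real.log n - Real.log L ≤ (n - L) / L := by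
        rw [← Real.log_div hn.ne' hL.ne']
        refine (Real.log_le_sub_one_of_pos (by positivity)).trans (le_of_eq ?_)
        field_simp
      have hup' : (L - n) / n ≤ 2 * |L - n| / n := by
        gcongr
        linarith [le_abs_self (L - n), abs_nonneg (L - n)]
      have hlo' : (n - L) / L ≤ 2 * |L - n| / n := by
        rw [div_le_div_iff₀ hL hn]
        have := neg_abs_le (L - n)
        nlinarith [abs_nonneg (L - n),
          mul_nonneg (abs_nonneg (L - n)) (by linarith : 0 ≤ 2 * L - n)]
      rw [abs_le]
      constructor <;> linarith
    have hratio : |A / L - m / n| ≤ |A - m| / n + b * |L - n| / n := by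
      have e : A / L - m / n = (A - m) / n + A / L * ((n - L) / n) := by
        field_simp
        ring
      have h3 : |A / L| ≤ b := by
        rw [abs_div, abs_of_pos hL, div_le_iff₀ hL]; exact hA
      rw [e]
      refine (abs_add_le _ _).trans ?_
      rw [abs_mul, abs_div (A - m), abs_div (n - L), abs_of_pos hn, abs_sub_comm n L, mul_div_assoc]
      gcongr
    have hd : |Real.log L - A / L - (Real.log n - m / n)| ≤ (|A - m| + 3 * b * |L - n|) / n := by
      have e : Real.log L - A / L - (Real.log n - m / n) =
          (Real.log L - Real.log n) - (A / L - m / n) := by ring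
      rw [e]
      refine (abs_sub _ _).trans ((add_le_add hlog hratio).trans ?_)
      rw [← add_div, ← add_div]
      refine div_le_div_of_nonneg_right ?_ hn.le
      nlinarith [abs_nonneg (L - n)]
    have hsq : (Real.log L - A / L - (Real.log n - m / n)) ^ 2 ≤
        (2 * (A - m) ^ 2 + 18 * b ^ 2 * (L - n) ^ 2) / n ^ 2 := by
      rw [← sq_abs]
      refine (pow_le_pow_left₀ (abs_nonneg _) hd 2).trans ?_
      rw [div_pow]
      gcongr
      rw [← sq_abs (A - m), ← sq_abs (L - n)]
      nlinarith [sq_nonneg (|A - m| - 3 * b * |L - n|)]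
    have hm := mul_le_mul_of_nonneg_left hsq (by positivity : 0 ≤ 8 / g ^ 2)
    have e : 8 / g ^ 2 * ((2 * (A - m) ^ 2 + 18 * b ^ 2 * (L - n) ^ 2) / n ^ 2) =
        (16 * (A - m) ^ 2 + 144 * b ^ 2 * (L - n) ^ 2) / (g * n) ^ 2 := by
      field_simp
      ring
    linarith

/-- Under the prior that draws the rates independently, the separation test at the prior mean of
the entropy functional rejects with small probability. -/
lemma tsum_prior_mul_separationTest_le {n : ℕ} (hn : 1 ≤ n) {R : ℝ} (hR : 0 ≤ R)
    {est : (Fin S → ℕ) → ℝ}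
    (hrisk : ∀ P ∈ simplex S, poissonRisk S n P (entropy S P) est ≤ ENNReal.ofReal R)
    {ℓ : Fin S → κ → ℝ} (hℓ : ∀ i j, 0 ≤ ℓ i j) (hpos : ∀ J : Fin S → κ, 0 < ∑ i, ℓ i (J i))
    (hp0 : ∀ j, 0 ≤ p j) (hp : ∑ j, p j = 1) (hmean : ∑ i, ∑ j, p j * ℓ i j = n)
    {b : ℝ} (hb : 1 ≤ b) (hlog : ∀ i j, |ℓ i j * Real.log (ℓ i j)| ≤ b * ℓ i j)
    {v w : ℝ} (hv : ∑ i, (∑ j, p j * ℓ i j ^ 2 - (∑ j, p j * ℓ i j) ^ 2) ≤ v)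
    (hw : ∑ i, (∑ j, p j * (ℓ i j * Real.log (ℓ i j)) ^ 2 -
      (∑ j, p j * (ℓ i j * Real.log (ℓ i j))) ^ 2) ≤ w)
    {g : ℝ} (hg : 0 < g) (hvn : 512 * v ≤ n)
    (hwg : 256 * w + 2304 * b ^ 2 * v ≤ (g * n) ^ 2) :
    ∑' z : Fin S → ℕ, (∏ i, ∑ j, p j * poi (ℓ i j) (z i)) *
      separationTest est g
        (Real.log n - (∑ i, ∑ j, p j * (ℓ i j * Real.log (ℓ i j))) / n) z ≤
      8 * R / g ^ 2 + 3 / 16 := by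
  classical
  have hn1 : (1 : ℝ) ≤ n := by exact_mod_cast hn
  have hn0 : (0 : ℝ) < n := by linarith
  set m := ∑ i, ∑ j, p j * (ℓ i j * Real.log (ℓ i j)) with hm
  set L : (Fin S → κ) → ℝ := fun J => ∑ i, ℓ i (J i) with hL
  set A : (Fin S → κ) → ℝ := fun J => ∑ i, ℓ i (J i) * Real.log (ℓ i (J i)) with hA
  set W : (Fin S → κ) → ℝ := fun J => ∏ i, p (J i) with hW
  have hW0 : ∀ J, 0 ≤ W J := fun J => Finset.prod_nonneg fun i _ => hp0 _
  have hW1 : ∑ J, W J = 1 := sum_pi_prod_eq_one hp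
  have hvar : ∑ J, W J * (L J - n) ^ 2 ≤ v := by
    rw [← hmean, sum_pi_prod_mul_sub_sq hp ℓ]; exact hv
  have hvarA : ∑ J, W J * (A J - m) ^ 2 ≤ w :=
    (sum_pi_prod_mul_sub_sq hp fun i j => ℓ i j * Real.log (ℓ i j)).trans_le hw
  have key := tsum_mixture_mul_separationTest_le (lam := n) hn0.le (F := entropy S) hR hrisk
    (g := g) (h := Real.log n - m / n) hg (W := W) hW0 hW1
    (P := fun J i => ℓ i (J i) / L J)
    (x := fun J => (16 * (A J - m) ^ 2 + 144 * b ^ 2 * (L J - n) ^ 2) / (g * n) ^ 2 +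
      4 * (L J - n) ^ 2 / n ^ 2)
    (t := fun J => (L J - n) ^ 2 / n / (2 * (1 / 32)) + 2 * (1 / 32))
    (q := fun J z => ∏ i, poi (ℓ i (J i)) (z i)) ?_ ?_ ?_ ?_ ?_
  · have e : ∀ z : Fin S → ℕ, ∑ J, W J * ∏ i, poi (ℓ i (J i)) (z i) =
        ∏ i, ∑ j, p j * poi (ℓ i j) (z i) := by
      intro z
      rw [Finset.prod_univ_sum, Fintype.piFinset_univ]
      exact Finset.sum_congr rfl fun J _ => by rw [hW, ← Finset.prod_mul_distrib]
    simp only [e] at key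
    refine key.trans (add_le_add le_rfl ?_)
    set α := 16 / (g * n) ^ 2 with hα
    set β := 144 * b ^ 2 / (g * n) ^ 2 + 4 / n ^ 2 + 16 / n with hβ
    have e2 : ∀ J, W J * ((16 * (A J - m) ^ 2 + 144 * b ^ 2 * (L J - n) ^ 2) / (g * n) ^ 2 +
        4 * (L J - n) ^ 2 / n ^ 2 + ((L J - n) ^ 2 / n / (2 * (1 / 32)) + 2 * (1 / 32))) =
        α * (W J * (A J - m) ^ 2) + β * (W J * (L J - n) ^ 2) + 1 / 16 * W J := by
      intro J
      rw [hα, hβ]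
      ring
    rw [Finset.sum_congr rfl fun J _ => e2 J, Finset.sum_add_distrib, Finset.sum_add_distrib,
      ← Finset.mul_sum, ← Finset.mul_sum, ← Finset.mul_sum, hW1]
    have hα0 : 0 ≤ α := by positivity
    have hβ0 : 0 ≤ β := by positivity
    have h1 := mul_le_mul_of_nonneg_left hvarA hα0
    have h2 := mul_le_mul_of_nonneg_left hvar hβ0
    have hv0 : 0 ≤ v := le_trans (Finset.sum_nonneg fun J _ =>
      mul_nonneg (hW0 J) (sq_nonneg _)) hvar
    have h3 : α * w + 144 * b ^ 2 / (g * n) ^ 2 * v ≤ 1 / 16 := by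
      rw [hα, div_mul_eq_mul_div, div_mul_eq_mul_div, ← add_div, div_le_iff₀ (by positivity)]
      linarith
    have h4 : 4 / (n : ℝ) ^ 2 * v ≤ 1 / 128 := by
      rw [div_mul_eq_mul_div, div_le_iff₀ (by positivity)]
      nlinarith
    have h5 : 16 / (n : ℝ) * v ≤ 1 / 32 := by
      rw [div_mul_eq_mul_div, div_le_iff₀ (by positivity)]
      linarith
    have h6 : β * v = 144 * b ^ 2 / (g * n) ^ 2 * v + 4 / (n : ℝ) ^ 2 * v + 16 / (n : ℝ) * v := by
      rw [hβ]; ring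
    linarith
  · exact fun J => ⟨fun i => div_nonneg (hℓ _ _) (hpos J).le, by
      rw [← Finset.sum_div]; exact div_self (hpos J).ne'⟩
  · exact fun J z => Finset.prod_nonneg fun i _ => poi_nonneg (hℓ _ _) _
  · exact fun J => (hasSum_pi_prod fun i => hasSum_poi (ℓ i (J i))).summable
  · intro J
    have h := l1Close_prod_poi (a := fun i => n * (ℓ i (J i) / L J)) (b := fun i => ℓ i (J i))
      (fun i => mul_nonneg hn0.le (div_nonneg (hℓ _ _) (hpos J).le)) (fun i => hℓ _ _)
      (by norm_num : (0 : ℝ) < 1 / 32)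
    refine ⟨h.1, h.2.trans ?_⟩
    gcongr
    exact sum_sq_sqrt_sub_normalized_le hn0 (fun i => hℓ i (J i)) (hpos J)
  · intro J
    simp only [hL]
    rw [entropy_normalized (fun i => hℓ i (J i)) (hpos J)]
    refine min_one_sq_entropy_sub_le hn0 (hpos J) hb ?_ hg
    rw [Finset.mul_sum]
    exact (Finset.abs_sum_le_sum_abs _ _).trans (Finset.sum_le_sum fun i _ => hlog _ _)

/-- Lower bound for the risk from two product priors on the rates. -/
theorem le_risk_of_priors {n : ℕ} (hn : 1 ≤ n) {R : ℝ} (hR : 0 ≤ R)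
    {est : (Fin S → ℕ) → ℝ}
    (hrisk : ∀ P ∈ simplex S, poissonRisk S n P (entropy S P) est ≤ ENNReal.ofReal R)
    {ℓ : Fin S → κ → ℝ} (hℓ : ∀ i j, 0 ≤ ℓ i j) (hpos : ∀ J : Fin S → κ, 0 < ∑ i, ℓ i (J i))
    {q : κ → ℝ} (hp0 : ∀ j, 0 ≤ p j) (hp : ∑ j, p j = 1) (hq0 : ∀ j, 0 ≤ q j)
    (hq : ∑ j, q j = 1) (hpmean : ∑ i, ∑ j, p j * ℓ i j = n)
    (hqmean : ∑ i, ∑ j, q j * ℓ i j = n)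
    {b : ℝ} (hb : 1 ≤ b) (hlog : ∀ i j, |ℓ i j * Real.log (ℓ i j)| ≤ b * ℓ i j)
    {v w : ℝ} (hpv : ∑ i, (∑ j, p j * ℓ i j ^ 2 - (∑ j, p j * ℓ i j) ^ 2) ≤ v)
    (hqv : ∑ i, (∑ j, q j * ℓ i j ^ 2 - (∑ j, q j * ℓ i j) ^ 2) ≤ v)
    (hpw : ∑ i, (∑ j, p j * (ℓ i j * Real.log (ℓ i j)) ^ 2 -
      (∑ j, p j * (ℓ i j * Real.log (ℓ i j))) ^ 2) ≤ w)
    (hqw : ∑ i, (∑ j, q j * (ℓ i j * Real.log (ℓ i j)) ^ 2 -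
      (∑ j, q j * (ℓ i j * Real.log (ℓ i j))) ^ 2) ≤ w)
    {G : ℝ} (hG : 0 < G) (hgap : G ≤ ∑ i, ∑ j, p j * (ℓ i j * Real.log (ℓ i j)) -
      ∑ i, ∑ j, q j * (ℓ i j * Real.log (ℓ i j)))
    (hvn : 512 * v ≤ n) (hwg : 256 * w + 2304 * b ^ 2 * v ≤ G ^ 2)
    {t : Fin S → ℝ} (hclose : ∀ i, L1Close (fun k => ∑ j, p j * poi (ℓ i j) k)
      (fun k => ∑ j, q j * poi (ℓ i j) k) (t i)) (ht : ∑ i, t i ≤ 1 / 8) :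
    1 / 32 * (G / n) ^ 2 ≤ R := by
  have hn0 : (0 : ℝ) < n := by exact_mod_cast hn
  have hg : 0 < G / n := by positivity
  have hgn : G / n * n = G := div_mul_cancel₀ _ hn0.ne'
  have h1 := tsum_prior_mul_separationTest_le hn hR hrisk hℓ hpos hp0 hp hpmean hb hlog hpv hpw hg
    hvn (by rwa [hgn])
  have h0 := tsum_prior_mul_separationTest_le hn hR hrisk hℓ hpos hq0 hq hqmean hb hlog hqv hqw hg
    hvn (by rwa [hgn])
  have hmix : ∀ r : κ → ℝ, (∀ j, 0 ≤ r j) → ∀ i k, 0 ≤ ∑ j, r j * poi (ℓ i j) k :=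
    fun r hr i k => Finset.sum_nonneg fun j _ => mul_nonneg (hr j) (poi_nonneg (hℓ i j) k)
  have hsum : ∀ r : κ → ℝ, ∑ j, r j = 1 →
      HasSum (fun z : Fin S → ℕ => ∏ i, ∑ j, r j * poi (ℓ i j) (z i)) 1 := fun r hr => by
    simpa using hasSum_pi_prod fun i => hasSum_sum_mul_poi hr (ℓ i)
  have hprod := L1Close.prod (fun i k => hmix p hp0 i k) (fun i k => hmix q hq0 i k)
    (fun i => hasSum_sum_mul_poi hp (ℓ i)) (fun i => hasSum_sum_mul_poi hq (ℓ i)) hclose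
  set mp := ∑ i, ∑ j, p j * (ℓ i j * Real.log (ℓ i j))
  set mq := ∑ i, ∑ j, q j * (ℓ i j * Real.log (ℓ i j))
  have key := one_le_of_separationTest hprod
    (fun z => Finset.prod_nonneg fun i _ => hmix q hq0 i _)
    (fun z => Finset.prod_nonneg fun i _ => hmix p hp0 i _) (hsum q hq) (hsum p hp).summable est
    (h₀ := Real.log n - mq / n) (h₁ := Real.log n - mp / n) hg (by
      refine le_trans ?_ (le_abs_self _)
      rw [show Real.log n - mq / n - (Real.log n - mp / n) = (mp - mq) / n by ring]
      gcongr)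
  have h2 : 1 / 2 ≤ 16 * R / (G / n) ^ 2 := by
    have e : 16 * R / (G / n) ^ 2 = 8 * R / (G / n) ^ 2 + 8 * R / (G / n) ^ 2 := by ring
    rw [e]
    linarith
  rw [le_div_iff₀ (by positivity)] at h2
  linarith

end Prior

lemma l1Close_sum_mul_poi {κ : Type*} [Fintype κ] {p q ℓ : κ → ℝ} (hp0 : ∀ j, 0 ≤ p j)
    (hq0 : ∀ j, 0 ≤ q j) (hp : ∑ j, p j = 1) (hq : ∑ j, q j = 1) {M : ℝ} (hℓ : ∀ j, 0 ≤ ℓ j)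
    (hM : ∀ j, ℓ j ≤ M) {L : ℕ} (hmatch : ∀ k < L, ∑ j, p j * ℓ j ^ k = ∑ j, q j * ℓ j ^ k)
    {A : ℝ} (hA : 1 ≤ A) :
    L1Close (fun k => ∑ j, p j * poi (ℓ j) k) (fun k => ∑ j, q j * poi (ℓ j) k)
      (2 * Real.exp (2 * (A * M)) / A ^ L) := by
  have hA0 : 0 < A := by linarith
  have hM0 : 0 ≤ M := by
    rcases isEmpty_or_nonempty κ with h | ⟨⟨j⟩⟩
    · simp at hp
    · exact (hℓ j).trans (hM j)
  have hmom : ∀ k, |∑ j, (p j - q j) * ℓ j ^ k| ≤ 2 / A ^ L * (A * M) ^ k := by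
    intro k
    rcases lt_or_ge k L with hk | hk
    · simp only [sub_mul, Finset.sum_sub_distrib, hmatch k hk, sub_self, abs_zero]
      positivity
    · have h1 : |∑ j, (p j - q j) * ℓ j ^ k| ≤ 2 * M ^ k := by
        calc |∑ j, (p j - q j) * ℓ j ^ k| ≤ ∑ j, (p j + q j) * M ^ k := by
              refine (Finset.abs_sum_le_sum_abs _ _).trans (Finset.sum_le_sum fun j _ => ?_)
              rw [abs_mul, abs_of_nonneg (pow_nonneg (hℓ j) k)]
              have := abs_sub (p j) (q j)
              rw [abs_of_nonneg (hp0 j), abs_of_nonneg (hq0 j)] at this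
              exact mul_le_mul this (pow_le_pow_left₀ (hℓ j) (hM j) k) (pow_nonneg (hℓ j) k)
                (add_nonneg (hp0 j) (hq0 j))
          _ = 2 * M ^ k := by
              rw [← Finset.sum_mul, Finset.sum_add_distrib, hp, hq]; norm_num
      refine h1.trans ?_
      have h2 : A ^ L ≤ A ^ k := pow_le_pow_right₀ hA hk
      rw [mul_pow, div_mul_eq_mul_div, le_div_iff₀ (by positivity)]
      have := mul_le_mul_of_nonneg_left h2 (by positivity : 0 ≤ 2 * M ^ k)
      linarith
  have hbound : HasSum (fun k : ℕ => 2 / A ^ L * Real.exp (A * M) *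
      ((A * M) ^ k / (Nat.factorial k : ℝ))) (2 / A ^ L * Real.exp (A * M) * Real.exp (A * M)) :=
    (hasSum_pow_div_factorial (A * M)).mul_left _
  refine L1Close.of_le hbound (fun k => ?_) (le_of_eq ?_)
  · have hs : HasSum (fun r : ℕ => ∑ j, (p j - q j) * (ℓ j ^ k / (Nat.factorial k : ℝ) *
        ((-ℓ j) ^ r / (Nat.factorial r : ℝ))))
        (∑ j, (p j - q j) * (ℓ j ^ k / (Nat.factorial k : ℝ) * Real.exp (-ℓ j))) :=
      hasSum_sum fun j _ => ((hasSum_pow_div_factorial (-ℓ j)).mul_left _).mul_left _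
    have hB : HasSum (fun r : ℕ => 2 / A ^ L * ((A * M) ^ k / (Nat.factorial k : ℝ)) *
        ((A * M) ^ r / (Nat.factorial r : ℝ)))
        (2 / A ^ L * ((A * M) ^ k / (Nat.factorial k : ℝ)) * Real.exp (A * M)) :=
      (hasSum_pow_div_factorial (A * M)).mul_left _
    have e : (∑ j, p j * poi (ℓ j) k) - ∑ j, q j * poi (ℓ j) k =
        ∑ j, (p j - q j) * (ℓ j ^ k / (Nat.factorial k : ℝ) * Real.exp (-ℓ j)) := by
      rw [← Finset.sum_sub_distrib]
      exact Finset.sum_congr rfl fun j _ => by rw [poi]; ring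
    have h := tsum_of_norm_bounded hB (f := fun r : ℕ => ∑ j, (p j - q j) *
      (ℓ j ^ k / (Nat.factorial k : ℝ) * ((-ℓ j) ^ r / (Nat.factorial r : ℝ)))) fun r => by
        have e2 : ∑ j, (p j - q j) * (ℓ j ^ k / (Nat.factorial k : ℝ) *
            ((-ℓ j) ^ r / (Nat.factorial r : ℝ))) =
            (-1) ^ r / (Nat.factorial k * Nat.factorial r : ℝ) *
              ∑ j, (p j - q j) * ℓ j ^ (k + r) := by
          rw [Finset.mul_sum]
          refine Finset.sum_congr rfl fun j _ => ?_
          rw [neg_pow, pow_add]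
          field_simp
        rw [e2, Real.norm_eq_abs, abs_mul, abs_div, abs_pow, abs_neg, abs_one, one_pow,
          abs_of_pos (by positivity : (0 : ℝ) < Nat.factorial k * Nat.factorial r)]
        refine (mul_le_mul_of_nonneg_left (hmom (k + r)) (by positivity)).trans (le_of_eq ?_)
        rw [pow_add]
        field_simp
    rw [hs.tsum_eq, Real.norm_eq_abs] at h
    rw [e]
    refine h.trans (le_of_eq ?_)
    ring
  · rw [two_mul (A * M), Real.exp_add]
    ring

/-- Lower bound for the risk from priors matching `N + 1` moments, in terms of the scale `s` of the
small rates. -/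
theorem le_risk_of_scale {T n N : ℕ} (hn : 2 ≤ n) (hT : 1 ≤ T) (hN : 1 ≤ N) {R : ℝ} (hR : 0 ≤ R)
    {est : (Fin (T + 1) → ℕ) → ℝ}
    (hrisk : ∀ P ∈ simplex (T + 1),
      poissonRisk (T + 1) n P (entropy (T + 1) P) est ≤ ENNReal.ofReal R)
    {s b A : ℝ} (hs : 0 < s) (hb : 1 ≤ b) (hnb : Real.log n ≤ b)
    (hsb : ∀ y, s ≤ y → y ≤ 4 * s * N ^ 2 → |Real.log y| ≤ b)
    (hsum : 36 * (T * s) ≤ n) (hvar : 512 * (31 * N * T * s ^ 2) ≤ n)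
    (hTb : 10 ^ 8 * b ^ 2 * N ≤ T) (hA : 1 ≤ A)
    (hclose : T * (2 * Real.exp (2 * (A * (4 * s * N ^ 2))) / A ^ (N + 2)) ≤ 1 / 8) :
    1 / 32 * (T * s / 33 / n) ^ 2 ≤ R := by
  obtain ⟨x, p, q, hx, hxN, hp0, hq0, hp, hq, hmatch, hx1, hx2, hgap⟩ := exists_matching_priors hN
  have hT' : (1 : ℝ) ≤ T := by exact_mod_cast hT
  have hn' : (2 : ℝ) ≤ n := by exact_mod_cast hn
  have hx0 : ∀ j, 0 ≤ x j := fun j => by rcases hx j with h | h <;> linarith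
  have hq1 : ∑ j, q j * x j = ∑ j, p j * x j := by
    simpa using (hmatch 1 (by omega)).symm
  have hq2 : ∑ j, q j * x j ^ 2 = ∑ j, p j * x j ^ 2 := (hmatch 2 (by omega)).symm
  set μ := ∑ j, p j * x j with hμ
  have hμ0 : 0 ≤ μ := Finset.sum_nonneg fun j _ => mul_nonneg (hp0 j) (hx0 j)
  set B : ℝ := n - T * (s * μ) with hB
  have hTs : T * (s * μ) ≤ n / 2 := by
    have : T * s * μ ≤ T * s * 18 := mul_le_mul_of_nonneg_left hx1 (by positivity)
    linarith
  have hTs0 : 0 ≤ T * (s * μ) := by positivity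
  have hB1 : 1 ≤ B := by linarith
  have hBn : B ≤ n := by linarith
  set ℓ : Fin (T + 1) → Fin (N + 3) → ℝ :=
    Fin.cons (fun _ => B) (fun _ j => s * x j) with hℓ
  have hℓ0 : ∀ j, ℓ 0 j = B := fun j => rfl
  have hℓs : ∀ (i : Fin T) j, ℓ i.succ j = s * x j := fun i j => rfl
  have hmul : ∀ (r f : Fin (N + 3) → ℝ) (c : ℝ), ∑ j, r j * (c * f j) = c * ∑ j, r j * f j := by
    intro r f c
    rw [Finset.mul_sum]
    exact Finset.sum_congr rfl fun j _ => by ring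
  have hlogb : ∀ j, |s * x j * Real.log (s * x j)| ≤ b * (s * x j) := by
    intro j
    rcases hx j with h | h
    · rw [h]; simp
    · have h1 : s ≤ s * x j := le_mul_of_one_le_right hs.le h
      have h2 := hsb (s * x j) h1 (by nlinarith [hxN j])
      rw [abs_mul, abs_of_pos (hs.trans_le h1), mul_comm]
      exact mul_le_mul_of_nonneg_right h2 (hs.trans_le h1).le
  have hmean : ∀ r : Fin (N + 3) → ℝ, ∑ j, r j = 1 → ∑ j, r j * x j = μ →
      ∑ i, ∑ j, r j * ℓ i j = n := by
    intro r hr hrμ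
    rw [Fin.sum_univ_succ]
    simp only [hℓ0, hℓs, hmul, hrμ, ← Finset.sum_mul, hr, Finset.sum_const, Finset.card_univ,
      Fintype.card_fin, nsmul_eq_mul]
    rw [hB]
    ring
  have hsecond : ∀ r : Fin (N + 3) → ℝ, (∀ j, 0 ≤ r j) → ∑ j, r j = 1 →
      ∑ j, r j * x j ^ 2 ≤ 31 * N → ∀ (f : ℝ → ℝ) (c : ℝ),
      (∀ j, f (s * x j) ^ 2 ≤ c * x j ^ 2) → 0 ≤ c →
      ∑ i, (∑ j, r j * f (ℓ i j) ^ 2 - (∑ j, r j * f (ℓ i j)) ^ 2) ≤ T * (c * (31 * N)) := by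
    intro r hr0 hr hr2 f c hf hc
    rw [Fin.sum_univ_succ]
    simp only [hℓ0, hℓs, ← Finset.sum_mul, hr, Finset.sum_const, Finset.card_univ,
      Fintype.card_fin, nsmul_eq_mul, one_mul, sub_self, zero_add]
    refine mul_le_mul_of_nonneg_left ?_ (by positivity)
    have h1 : ∑ j, r j * f (s * x j) ^ 2 ≤ c * ∑ j, r j * x j ^ 2 := by
      rw [← hmul]
      exact Finset.sum_le_sum fun j _ => mul_le_mul_of_nonneg_left (hf j) (hr0 j)
    have h2 := mul_le_mul_of_nonneg_left hr2 hc
    linarith [sq_nonneg (∑ j, r j * f (s * x j))]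
  have hfsq : ∀ j, (s * x j * Real.log (s * x j)) ^ 2 ≤ b ^ 2 * s ^ 2 * x j ^ 2 := by
    intro j
    rw [← sq_abs]
    refine (pow_le_pow_left₀ (abs_nonneg _) (hlogb j) 2).trans (le_of_eq (by ring))
  have hidsq : ∀ j, (s * x j) ^ 2 ≤ s ^ 2 * x j ^ 2 := fun j => by rw [mul_pow]
  have hG : ∑ i, ∑ j, p j * (ℓ i j * Real.log (ℓ i j)) -
      ∑ i, ∑ j, q j * (ℓ i j * Real.log (ℓ i j)) =
      T * s * (∑ j, p j * (x j * Real.log (x j)) - ∑ j, q j * (x j * Real.log (x j))) := by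
    have hlin : ∀ r : Fin (N + 3) → ℝ, ∑ j, r j * x j = μ →
        ∑ j, r j * (s * x j * Real.log (s * x j)) =
          s * ∑ j, r j * (x j * Real.log (x j)) + s * Real.log s * μ := by
      intro r hrμ
      rw [← hrμ, Finset.mul_sum, Finset.mul_sum, ← Finset.sum_add_distrib]
      refine Finset.sum_congr rfl fun j _ => ?_
      rcases hx j with h | h
      · rw [h]; simp
      · rw [Real.log_mul hs.ne' (by linarith)]
        ring
    simp only [Fin.sum_univ_succ (n := T), hℓ0, hℓs, hlin p rfl, hlin q hq1, ← Finset.sum_mul, hp,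
      hq, Finset.sum_const, Finset.card_univ, Fintype.card_fin, nsmul_eq_mul]
    ring
  refine le_risk_of_priors (S := T + 1) (ℓ := ℓ) (p := p) (q := q) (by omega) hR hrisk
    ?_ ?_ hp0 hp hq0 hq (hmean p hp rfl) (hmean q hq hq1) hb ?_
    (hsecond p hp0 hp hx2 (fun y => y) (s ^ 2) hidsq (by positivity))
    (hsecond q hq0 hq (hq2.trans_le hx2) (fun y => y) (s ^ 2) hidsq (by positivity))
    (hsecond p hp0 hp hx2 (fun y => y * Real.log y) (b ^ 2 * s ^ 2) hfsq (by positivity))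
    (hsecond q hq0 hq (hq2.trans_le hx2) (fun y => y * Real.log y) (b ^ 2 * s ^ 2) hfsq
      (by positivity)) (by positivity) ?_ ?_ ?_
    (t := Fin.cons 0 fun _ => 2 * Real.exp (2 * (A * (4 * s * N ^ 2))) / A ^ (N + 2)) ?_ ?_
  · intro i j
    refine Fin.cases ?_ (fun i => ?_) i
    · rw [hℓ0]; linarith
    · rw [hℓs]; exact mul_nonneg hs.le (hx0 j)
  · intro J
    rw [Fin.sum_univ_succ, hℓ0]
    have : 0 ≤ ∑ i : Fin T, ℓ i.succ (J i.succ) :=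
      Finset.sum_nonneg fun i _ => by rw [hℓs]; exact mul_nonneg hs.le (hx0 _)
    linarith
  · intro i j
    refine Fin.cases ?_ (fun i => ?_) i
    · rw [hℓ0, abs_mul, abs_of_pos (by linarith), abs_of_nonneg (Real.log_nonneg hB1), mul_comm]
      refine mul_le_mul_of_nonneg_right (le_trans ?_ hnb) (by linarith)
      exact Real.log_le_log (by linarith) hBn
    · rw [hℓs]; exact hlogb j
  · rw [hG]
    have := mul_le_mul_of_nonneg_left hgap (by positivity : 0 ≤ T * s)
    linarith
  · linarith
  · have h := mul_le_mul_of_nonneg_left hTb (by positivity : 0 ≤ T * s ^ 2)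
    have h2 : 0 ≤ T * s ^ 2 * b ^ 2 * N := by positivity
    linarith
  · intro i
    refine Fin.cases ?_ (fun i => ?_) i
    · simp only [hℓ0, ← Finset.sum_mul, hp, hq, one_mul, Fin.cons_zero]
      exact L1Close.refl _
    · simp only [hℓs, Fin.cons_succ]
      refine l1Close_sum_mul_poi hp0 hq0 hp hq (fun j => mul_nonneg hs.le (hx0 j))
        (fun j => by nlinarith [hxN j]) (fun k hk => ?_) hA
      simp only [mul_pow, hmul]
      rw [hmatch k hk]
  · rw [Fin.sum_univ_succ]
    simpa using hclose

lemma eventually_mul_log_pow_le (C : ℝ) {d : ℝ} (hd : 0 < d) (k : ℕ) :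
    ∀ᶠ S : ℕ in Filter.atTop, C * Real.log S ^ k ≤ d * S := by
  have h := (Real.isLittleO_pow_log_id_atTop (n := k)).comp_tendsto
    (tendsto_natCast_atTop_atTop (R := ℝ))
  have hc : 0 < d / (|C| + 1) := by positivity
  filter_upwards [h.def hc] with S hS
  simp only [Function.comp_apply, id, Real.norm_eq_abs, Nat.abs_cast] at hS
  rw [div_mul_eq_mul_div, le_div_iff₀ (by positivity)] at hS
  have h1 : C * Real.log S ^ k ≤ |C| * |Real.log S ^ k| := by
    rw [← abs_mul]; exact le_abs_self _
  nlinarith [abs_nonneg (Real.log S ^ k)]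

/-- The bias part of the minimax lower bound. -/
theorem exists_le_risk_of_le_sq {c₀ : ℝ} (hc₀ : 0 < c₀) :
    ∃ c : ℝ, 0 < c ∧ ∃ S₀ : ℕ, 1 ≤ S₀ ∧ ∀ S n : ℕ, S₀ ≤ S → 2 ≤ n →
      c₀ * S ≤ n * Real.log S → n ≤ S ^ 2 → ∀ (est : (Fin S → ℕ) → ℝ) (R : ℝ), 0 ≤ R →
      (∀ P ∈ simplex S, poissonRisk S n P (entropy S P) est ≤ ENNReal.ofReal R) →
      c * ((S : ℝ) ^ 2 / (n * Real.log n) ^ 2) ≤ R := by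
  set κ : ℝ := min (1 / 200) (c₀ / 80) with hκ
  have hκ0 : 0 < κ := lt_min (by norm_num) (by positivity)
  have hκ1 : κ ≤ 1 / 200 := min_le_left _ _
  have hκ2 : κ ≤ c₀ / 80 := min_le_right _ _
  have hlog : ∀ᶠ S : ℕ in Filter.atTop, 1 + Real.log (1 / κ) ≤ Real.log S :=
    (Real.tendsto_log_atTop.comp (tendsto_natCast_atTop_atTop (R := ℝ))).eventually_ge_atTop _
  obtain ⟨S₀, hS₀⟩ := Filter.eventually_atTop.1 (hlog.and
    ((eventually_mul_log_pow_le (16 * 10 ^ 8) one_pos 3).and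
      ((eventually_mul_log_pow_le 1 (by positivity : 0 < c₀ ^ 2) 2).and
        (Filter.eventually_ge_atTop 16))))
  refine ⟨1 / 32 * (κ / 264) ^ 2, by positivity, max S₀ 1, le_max_right _ _, ?_⟩
  intro S n hS hn hc hnS est R hR hrisk
  obtain ⟨hl, h3, h2, h16⟩ := hS₀ S ((le_max_left _ _).trans hS)
  obtain ⟨T, rfl⟩ : ∃ T, S = T + 1 := ⟨S - 1, by omega⟩
  set l := Real.log ((T + 1 : ℕ) : ℝ) with hldef
  have hS16 : (16 : ℝ) ≤ ((T + 1 : ℕ) : ℝ) := by exact_mod_cast h16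
  set σ : ℝ := ((T + 1 : ℕ) : ℝ) with hσ
  have hTσ : (T : ℝ) = σ - 1 := by rw [hσ]; push_cast; ring
  have hT0 : (0 : ℝ) ≤ T := Nat.cast_nonneg T
  have hσ0 : 0 < σ := by linarith
  have hn' : (2 : ℝ) ≤ n := by exact_mod_cast hn
  have hlogn : 0 < Real.log n := Real.log_pos (by linarith)
  have hlκ : 0 ≤ Real.log (1 / κ) := Real.log_nonneg (by
    rw [le_div_iff₀ hκ0]; linarith)
  have hl1 : 1 ≤ l := by linarith
  have hl0 : 0 < l := by linarith
  set N := ⌈l⌉₊ with hNdef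
  have hNl : l ≤ N := Nat.le_ceil l
  have hNu : (N : ℝ) ≤ l + 1 := (Nat.ceil_lt_add_one hl0.le).le
  have hN1 : 1 ≤ N := Nat.ceil_pos.2 hl0
  have hN0 : (0 : ℝ) < N := by linarith
  have hlogN : Real.log N ≤ N - 1 := Real.log_le_sub_one_of_pos hN0
  have hTN : (T : ℝ) / N ≤ n / c₀ := by
    rw [div_le_div_iff₀ hN0 hc₀]
    have : (n : ℝ) * l ≤ n * N := by gcongr
    nlinarith
  have hsqrt : l ≤ 2 * Real.log n := by
    have h : σ ≤ (n : ℝ) ^ 2 := by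
      have e1 : (c₀ * σ) ^ 2 ≤ (n * l) ^ 2 := pow_le_pow_left₀ (by positivity) hc 2
      have e2 : (n : ℝ) ^ 2 * (1 * l ^ 2) ≤ (n : ℝ) ^ 2 * (c₀ ^ 2 * σ) := by gcongr
      have e3 : c₀ ^ 2 * σ * σ ≤ c₀ ^ 2 * σ * (n : ℝ) ^ 2 := by nlinarith
      exact le_of_mul_le_mul_left e3 (by positivity)
    have h' := Real.log_le_log hσ0 h
    rw [Real.log_pow] at h'
    exact_mod_cast h'
  have key := le_risk_of_scale (T := T) (n := n) (N := N) (s := κ / N) (b := 2 * l)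
    (A := Real.exp 3) hn (by omega) hN1 hR hrisk (by positivity) (by linarith) ?_ ?_ ?_ ?_ ?_
    (Real.one_le_exp (by norm_num)) ?_
  · refine le_trans ?_ key
    have h : κ / 264 * (σ / (n * Real.log n)) ≤ T * (κ / N) / 33 / n := by
      have e : T * (κ / N) / 33 / n = κ * T / (33 * n * N) := by field_simp
      have e' : κ / 264 * (σ / (n * Real.log n)) = κ * σ / (264 * (n * Real.log n)) := by
        field_simp
      rw [e, e', div_le_div_iff₀ (by positivity) (by positivity)]
      have a1 : σ ≤ 2 * T := by linarith
      have a2 : (N : ℝ) ≤ 4 * Real.log n := by linarith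
      have a3 : σ * N ≤ 2 * T * (4 * Real.log n) := by gcongr
      have a4 := mul_le_mul_of_nonneg_left a3 (by positivity : 0 ≤ κ * n * 33)
      linarith
    calc 1 / 32 * (κ / 264) ^ 2 * (σ ^ 2 / (n * Real.log n) ^ 2) =
          1 / 32 * (κ / 264 * (σ / (n * Real.log n))) ^ 2 := by
            rw [mul_pow (κ / 264), div_pow σ]; ring
      _ ≤ _ := by gcongr
  · have h := Real.log_le_log (by linarith) (by rw [hσ]; exact_mod_cast hnS : (n : ℝ) ≤ σ ^ 2)
    rw [Real.log_pow] at h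
    exact_mod_cast h
  · intro y hy1 hy2
    have hy0 : 0 < y := lt_of_lt_of_le (by positivity) hy1
    have h1 : Real.log (κ / N) ≤ Real.log y := Real.log_le_log (by positivity) hy1
    have h2 : Real.log y ≤ Real.log N := by
      refine Real.log_le_log hy0 (hy2.trans ?_)
      have e : 4 * (κ / N) * (N : ℝ) ^ 2 = 4 * κ * N := by field_simp
      rw [e]
      nlinarith
    rw [Real.log_div hκ0.ne' hN0.ne'] at h1
    rw [one_div, Real.log_inv] at hl
    rw [abs_le]
    constructor <;> linarith
  · have e : 36 * (T * (κ / N)) = 36 * κ * (T / N) := by ring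
    rw [e]
    calc 36 * κ * (T / N) ≤ 36 * (c₀ / 80) * (n / c₀) := by gcongr
      _ = 36 / 80 * n := by field_simp
      _ ≤ n := by linarith
  · have e : 512 * (31 * N * T * (κ / N) ^ 2) = 15872 * κ * κ * (T / N) := by
      field_simp
      ring
    rw [e]
    calc 15872 * κ * κ * (T / N) ≤ 15872 * (1 / 200) * (c₀ / 80) * (n / c₀) := by gcongr
      _ = 15872 / 16000 * n := by field_simp; ring
      _ ≤ n := by linarith
  · have : l ^ 2 * N ≤ l ^ 2 * (2 * l) := by gcongr; linarith
    linarith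
  · have e3 : Real.exp 3 ≤ 25 := by
      have h := Real.exp_one_lt_d9
      have : Real.exp 3 = Real.exp 1 ^ 3 := by rw [← Real.exp_nat_mul]; norm_num
      rw [this]
      calc Real.exp 1 ^ 3 ≤ 2.8 ^ 3 := by gcongr; linarith
        _ ≤ 25 := by norm_num
    have h1 : 2 * (Real.exp 3 * (4 * (κ / N) * (N : ℝ) ^ 2)) ≤ N := by
      have e : 2 * (Real.exp 3 * (4 * (κ / N) * (N : ℝ) ^ 2)) = 8 * Real.exp 3 * κ * N := by
        field_simp
        ring
      rw [e]
      calc 8 * Real.exp 3 * κ * N ≤ 8 * 25 * (1 / 200) * N := by gcongr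
        _ = N := by ring
    have h4 : Real.exp 3 ^ (N + 2) = Real.exp (3 * (N + 2)) := by
      rw [← Real.exp_nat_mul]; push_cast; ring_nf
    rw [h4, mul_div_assoc, ← Real.exp_sub]
    have h5 : Real.exp (2 * (Real.exp 3 * (4 * (κ / N) * (N : ℝ) ^ 2)) - 3 * (N + 2)) ≤
        Real.exp (-(2 * l)) := Real.exp_le_exp.2 (by linarith)
    have h6 : Real.exp (-(2 * l)) = 1 / σ ^ 2 := by
      rw [Real.exp_neg, two_mul, Real.exp_add, hldef, Real.exp_log hσ0, sq, one_div]
    rw [h6] at h5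
    calc _ ≤ σ * (2 * (1 / σ ^ 2)) := by gcongr; linarith
      _ = 2 / σ := by field_simp
      _ ≤ 1 / 8 := by rw [div_le_div_iff₀ hσ0 (by norm_num)]; linarith

theorem entropy_minimax_rate (c₀ : ℝ) (hc₀ : 0 < c₀) :
    ∃ C₁ C₂ : ℝ, 0 < C₁ ∧ 0 < C₂ ∧
      ∀ S n : ℕ, 2 ≤ S → 2 ≤ n → c₀ * (S : ℝ) ≤ (n : ℝ) * Real.log S →
        ENNReal.ofReal (C₁ * ((S : ℝ) ^ 2 / ((n : ℝ) * Real.log n) ^ 2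
              + (Real.log S) ^ 2 / (n : ℝ)))
            ≤ poissonMinimax S (n : ℝ) (entropy S) ∧
        poissonMinimax S (n : ℝ) (entropy S)
            ≤ ENNReal.ofReal (C₂ * ((S : ℝ) ^ 2 / ((n : ℝ) * Real.log n) ^ 2
              + (Real.log S) ^ 2 / (n : ℝ))) := by
  obtain ⟨c, hc, S₀, hS₀, hbias⟩ := exists_le_risk_of_le_sq hc₀
  have hl2 : 0 < Real.log 2 := Real.log_pos one_lt_two
  set K : ℝ := (S₀ : ℝ) ^ 2 / Real.log 2 ^ 4 with hK
  have hK0 : 0 ≤ K := by positivity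
  set C₁ : ℝ := min (min (c / 2) (1 / 8000)) (1 / 4000 / (1 + K)) with hC₁
  have hC₁0 : 0 < C₁ := by positivity
  refine ⟨C₁, 20000, hC₁0, by norm_num, fun S n hS hn hSn =>
    ⟨le_poissonMinimax fun est R hR hrisk => ?_, poissonMinimax_entropy_le hS hn⟩⟩
  have hn1 : (2 : ℝ) ≤ n := by exact_mod_cast hn
  have hS1 : (2 : ℝ) ≤ S := by exact_mod_cast hS
  have hn0 : (0 : ℝ) < n := by linarith
  have hlS : Real.log 2 ≤ Real.log S := Real.log_le_log two_pos hS1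
  have hln : Real.log 2 ≤ Real.log n := Real.log_le_log two_pos hn1
  have hln0 : 0 < Real.log n := hl2.trans_le hln
  have hvar := le_risk_two_point hS hn hR hrisk
  set A : ℝ := (S : ℝ) ^ 2 / ((n : ℝ) * Real.log n) ^ 2 with hA
  set B : ℝ := (Real.log S) ^ 2 / (n : ℝ) with hB
  have hA0 : 0 ≤ A := by positivity
  have hB0 : 0 ≤ B := by positivity
  have h1 : C₁ ≤ c / 2 := (min_le_left _ _).trans (min_le_left _ _)
  have h2 : C₁ ≤ 1 / 8000 := (min_le_left _ _).trans (min_le_right _ _)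
  have h3 : C₁ ≤ 1 / 4000 / (1 + K) := min_le_right _ _
  by_cases hcase : S₀ ≤ S ∧ n ≤ S ^ 2
  · have hb := hbias S n hcase.1 hn hSn hcase.2 est R hR hrisk
    nlinarith
  · have hle : (S : ℝ) ^ 2 ≤ (S₀ : ℝ) ^ 2 * n := by
      have : S ^ 2 ≤ S₀ ^ 2 * n := by
        rcases not_and_or.mp hcase with h | h
        · have := Nat.pow_le_pow_left (not_le.mp h).le 2
          nlinarith
        · have := Nat.one_le_pow 2 S₀ hS₀
          nlinarith [not_le.mp h]
      exact_mod_cast this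
    have hAB : A ≤ K * B := by
      have hKB : K * B = (S₀ : ℝ) ^ 2 * Real.log S ^ 2 / (Real.log 2 ^ 4 * n) := by
        rw [hK, hB]; field_simp
      rw [hKB, hA, div_le_div_iff₀ (by positivity) (by positivity)]
      calc (S : ℝ) ^ 2 * (Real.log 2 ^ 4 * n) =
            (S : ℝ) ^ 2 * (Real.log 2 ^ 2 * Real.log 2 ^ 2 * n) := by ring
        _ ≤ ((S₀ : ℝ) ^ 2 * n) * (Real.log S ^ 2 * Real.log n ^ 2 * n) := by gcongr
        _ = _ := by ring
    calc C₁ * (A + B) ≤ 1 / 4000 / (1 + K) * (K * B + B) := by gcongr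
      _ = 1 / 4000 * B := by field_simp; ring
      _ ≤ R := hvar
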